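/- Let f, g, h be twice continuously differentiable. Let (x*, y*) be a strict local minimum of the continuous reformulation with respect to x with ‖x*‖₀ = κ such that CC-MFCQ holds at x* and d_xᵀ(∇²f(x*) + Σᵢ λᵢ∇²gᵢ(x*) + Σᵢ μᵢ∇²hᵢ(x*))d_x > 0 for all (d_x, d_y) ∈ C_Z(x*,y*) with d_x ≠ 0 and all S-stationary multipliers (λ, μ, γ) of (x*, y*). Then there exists r > 0 such that for every sequence (t_k) of positive reals with t_k → 0: for all sufficiently large k the program NLP(t_k) has a KKT point (x^k, y^k) with ‖x^k − x*‖ < r, and every such sequence of KKT points converges to (x*, y*). -/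

import Mathlib

open Set Filter Topology

noncomputable section

/-- Number of nonzero components of a vector (the "zero norm"). -/
def card0 {n : ℕ} (x : Fin n → ℝ) : ℕ := {i | x i ≠ 0}.ncard

/-- First directional derivative `∇φ(x)ᵀd`. -/
def D1 {n : ℕ} (φ : (Fin n → ℝ) → ℝ) (x d : Fin n → ℝ) : ℝ := fderiv ℝ φ x d

/-- Second derivative quadratic form `dᵀ∇²φ(x)d`. -/
def D2 {n : ℕ} (φ : (Fin n → ℝ) → ℝ) (x d : Fin n → ℝ) : ℝ :=
  iteratedFDeriv ℝ 2 φ x ![d, d]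

/-- Feasibility for the cardinality constrained problem (CCP):
`g(x) ≤ 0`, `h(x) = 0`, `‖x‖₀ ≤ κ`. -/
def CCPFeasible {n m p : ℕ} (g : (Fin n → ℝ) → Fin m → ℝ) (h : (Fin n → ℝ) → Fin p → ℝ)
    (κ : ℕ) (x : Fin n → ℝ) : Prop :=
  (∀ i, g x i ≤ 0) ∧ (∀ i, h x i = 0) ∧ card0 x ≤ κ

/-- Feasible set `Z` of the continuous reformulation. -/
def ZSet {n m p : ℕ} (g : (Fin n → ℝ) → Fin m → ℝ) (h : (Fin n → ℝ) → Fin p → ℝ)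
    (κ : ℕ) : Set ((Fin n → ℝ) × (Fin n → ℝ)) :=
  {z | (∀ i, g z.1 i ≤ 0) ∧ (∀ i, h z.1 i = 0) ∧ (∀ i, 0 ≤ z.2 i) ∧ (∀ i, z.2 i ≤ 1) ∧
    ((n : ℝ) - (κ : ℝ) ≤ ∑ i, z.2 i) ∧ ∀ i, z.1 i * z.2 i = 0}

/-- `(lam, mu, gam)` is an M-stationary multiplier at `x`. -/
def IsMMult {n m p : ℕ} (f : (Fin n → ℝ) → ℝ) (g : (Fin n → ℝ) → Fin m → ℝ)
    (h : (Fin n → ℝ) → Fin p → ℝ) (x : Fin n → ℝ)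
    (lam : Fin m → ℝ) (mu : Fin p → ℝ) (gam : Fin n → ℝ) : Prop :=
  (∀ d, D1 f x d + ∑ i, lam i * D1 (fun x' => g x' i) x d
      + ∑ i, mu i * D1 (fun x' => h x' i) x d + ∑ i, gam i * d i = 0) ∧
  (∀ i, 0 ≤ lam i) ∧ (∀ i, lam i * g x i = 0) ∧ (∀ i, x i ≠ 0 → gam i = 0)

/-- `(lam, mu, gam)` is an S-stationary multiplier at `(x, y)`. -/
def IsSMult {n m p : ℕ} (f : (Fin n → ℝ) → ℝ) (g : (Fin n → ℝ) → Fin m → ℝ)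
    (h : (Fin n → ℝ) → Fin p → ℝ) (x y : Fin n → ℝ)
    (lam : Fin m → ℝ) (mu : Fin p → ℝ) (gam : Fin n → ℝ) : Prop :=
  IsMMult f g h x lam mu gam ∧ ∀ i, x i = 0 → y i = 0 → gam i = 0

/-- `z` is an M-stationary point of the continuous reformulation. -/
def MStationary {n m p : ℕ} (f : (Fin n → ℝ) → ℝ) (g : (Fin n → ℝ) → Fin m → ℝ)
    (h : (Fin n → ℝ) → Fin p → ℝ) (κ : ℕ) (z : (Fin n → ℝ) × (Fin n → ℝ)) : Prop :=
  z ∈ ZSet g h κ ∧ ∃ lam mu gam, IsMMult f g h z.1 lam mu gam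

/-- `z` is an S-stationary point of the continuous reformulation. -/
def SStationary {n m p : ℕ} (f : (Fin n → ℝ) → ℝ) (g : (Fin n → ℝ) → Fin m → ℝ)
    (h : (Fin n → ℝ) → Fin p → ℝ) (κ : ℕ) (z : (Fin n → ℝ) × (Fin n → ℝ)) : Prop :=
  z ∈ ZSet g h κ ∧ ∃ lam mu gam, IsSMult f g h z.1 z.2 lam mu gam

/-- CC-LICQ at `x`: the active gradients `∇gᵢ(x)` (`gᵢ(x) = 0`), all `∇hᵢ(x)`,
and the unit vectors `eᵢ` (`xᵢ = 0`) are linearly independent. -/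
def CCLICQ {n m p : ℕ} (g : (Fin n → ℝ) → Fin m → ℝ) (h : (Fin n → ℝ) → Fin p → ℝ)
    (x : Fin n → ℝ) : Prop :=
  ∀ (lam : Fin m → ℝ) (mu : Fin p → ℝ) (gam : Fin n → ℝ),
    (∀ i, g x i ≠ 0 → lam i = 0) → (∀ i, x i ≠ 0 → gam i = 0) →
    (∀ d, ∑ i, lam i * D1 (fun x' => g x' i) x d
        + ∑ i, mu i * D1 (fun x' => h x' i) x d + ∑ i, gam i * d i = 0) →
    lam = 0 ∧ mu = 0 ∧ gam = 0

/-- CC-MFCQ at `x`: the active gradients `∇gᵢ(x)` together with all `∇hᵢ(x)` and the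
unit vectors `eᵢ` (`xᵢ = 0`) are positively linearly independent. -/
def CCMFCQ {n m p : ℕ} (g : (Fin n → ℝ) → Fin m → ℝ) (h : (Fin n → ℝ) → Fin p → ℝ)
    (x : Fin n → ℝ) : Prop :=
  ∀ (lam : Fin m → ℝ) (mu : Fin p → ℝ) (gam : Fin n → ℝ),
    (∀ i, 0 ≤ lam i) → (∀ i, g x i ≠ 0 → lam i = 0) → (∀ i, x i ≠ 0 → gam i = 0) →
    (∀ d, ∑ i, lam i * D1 (fun x' => g x' i) x d
        + ∑ i, mu i * D1 (fun x' => h x' i) x d + ∑ i, gam i * d i = 0) →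
    lam = 0 ∧ mu = 0 ∧ gam = 0

/-- The linear combination `Σ lamᵢ ∇gᵢ(x) + Σ muᵢ ∇hᵢ(x) + Σ gamᵢ eᵢ` vanishes. -/
def CombZero {n m p : ℕ} (g : (Fin n → ℝ) → Fin m → ℝ) (h : (Fin n → ℝ) → Fin p → ℝ)
    (lam : Fin m → ℝ) (mu : Fin p → ℝ) (gam : Fin n → ℝ) (x : Fin n → ℝ) : Prop :=
  ∀ d, ∑ i, lam i * D1 (fun x' => g x' i) x d
      + ∑ i, mu i * D1 (fun x' => h x' i) x d + ∑ i, gam i * d i = 0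

/-- CC-CPLD at `x`: whenever gradients indexed by subsets of the active sets are
positively linearly dependent at `x`, they remain linearly dependent nearby. -/
def CCCPLD {n m p : ℕ} (g : (Fin n → ℝ) → Fin m → ℝ) (h : (Fin n → ℝ) → Fin p → ℝ)
    (x : Fin n → ℝ) : Prop :=
  ∀ (I1 : Finset (Fin m)) (I2 : Finset (Fin p)) (I3 : Finset (Fin n)),
    (∀ i ∈ I1, g x i = 0) → (∀ i ∈ I3, x i = 0) →
    (∃ lam mu gam, (∀ i, 0 ≤ lam i) ∧ (∀ i, i ∉ I1 → lam i = 0) ∧ (∀ i, i ∉ I2 → mu i = 0) ∧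
      (∀ i, i ∉ I3 → gam i = 0) ∧ ¬(lam = 0 ∧ mu = 0 ∧ gam = 0) ∧ CombZero g h lam mu gam x) →
    ∀ᶠ x' in nhds x, ∃ lam mu gam, (∀ i, i ∉ I1 → lam i = 0) ∧ (∀ i, i ∉ I2 → mu i = 0) ∧
      (∀ i, i ∉ I3 → gam i = 0) ∧ ¬(lam = 0 ∧ mu = 0 ∧ gam = 0) ∧ CombZero g h lam mu gam x'

/-- The CC-linearisation cone `L_Z(x, y)` (as a predicate on `(dx, dy)`). -/
def LinCone {n m p : ℕ} (g : (Fin n → ℝ) → Fin m → ℝ) (h : (Fin n → ℝ) → Fin p → ℝ)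
    (κ : ℕ) (x y dx dy : Fin n → ℝ) : Prop :=
  (∀ i, g x i = 0 → D1 (fun x' => g x' i) x dx ≤ 0) ∧
  (∀ i, D1 (fun x' => h x' i) x dx = 0) ∧
  ((∑ i, y i = (n : ℝ) - (κ : ℝ)) → 0 ≤ ∑ i, dy i) ∧
  (∀ i, x i ≠ 0 → y i = 0 → dy i = 0) ∧
  (∀ i, x i = 0 → y i = 0 → 0 ≤ dy i) ∧
  (∀ i, x i = 0 → y i = 1 → dy i ≤ 0) ∧
  (∀ i, x i = 0 → 0 < y i → dx i = 0) ∧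
  (∀ i, x i = 0 → y i = 0 → dx i * dy i = 0)

/-- The CC-critical cone `C_Z(x, y)`. -/
def CritCone {n m p : ℕ} (f : (Fin n → ℝ) → ℝ) (g : (Fin n → ℝ) → Fin m → ℝ)
    (h : (Fin n → ℝ) → Fin p → ℝ) (κ : ℕ) (x y dx dy : Fin n → ℝ) : Prop :=
  LinCone g h κ x y dx dy ∧ D1 f x dx ≤ 0

/-- The critical cone `C_X(x)` for the original cardinality constrained problem. -/
def CritConeX {n m p : ℕ} (f : (Fin n → ℝ) → ℝ) (g : (Fin n → ℝ) → Fin m → ℝ)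
    (h : (Fin n → ℝ) → Fin p → ℝ) (κ : ℕ) (x dx : Fin n → ℝ) : Prop :=
  (∀ i, g x i = 0 → D1 (fun x' => g x' i) x dx ≤ 0) ∧
  (∀ i, D1 (fun x' => h x' i) x dx = 0) ∧
  (n - κ ≤ {i | x i = 0 ∧ dx i = 0}.ncard) ∧
  D1 f x dx ≤ 0

/-- `x` is a local minimum of the cardinality constrained problem. -/
def LocalMinCCP {n m p : ℕ} (f : (Fin n → ℝ) → ℝ) (g : (Fin n → ℝ) → Fin m → ℝ)
    (h : (Fin n → ℝ) → Fin p → ℝ) (κ : ℕ) (x : Fin n → ℝ) : Prop :=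
  CCPFeasible g h κ x ∧ ∃ r > (0 : ℝ), ∀ x', CCPFeasible g h κ x' → dist x' x < r → f x ≤ f x'

/-- `x` is a strict local minimum of the cardinality constrained problem. -/
def StrictLocalMinCCP {n m p : ℕ} (f : (Fin n → ℝ) → ℝ) (g : (Fin n → ℝ) → Fin m → ℝ)
    (h : (Fin n → ℝ) → Fin p → ℝ) (κ : ℕ) (x : Fin n → ℝ) : Prop :=
  CCPFeasible g h κ x ∧
    ∃ r > (0 : ℝ), ∀ x', CCPFeasible g h κ x' → dist x' x < r → x' ≠ x → f x < f x'

/-- `z` is a local minimum of the continuous reformulation. -/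
def LocalMinZ {n m p : ℕ} (f : (Fin n → ℝ) → ℝ) (g : (Fin n → ℝ) → Fin m → ℝ)
    (h : (Fin n → ℝ) → Fin p → ℝ) (κ : ℕ) (z : (Fin n → ℝ) × (Fin n → ℝ)) : Prop :=
  z ∈ ZSet g h κ ∧ ∃ r > (0 : ℝ), ∀ z' ∈ ZSet g h κ, dist z' z < r → f z.1 ≤ f z'.1

/-- `z` is a strict local minimum with respect to `x` of the continuous reformulation. -/
def StrictLocalMinX {n m p : ℕ} (f : (Fin n → ℝ) → ℝ) (g : (Fin n → ℝ) → Fin m → ℝ)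
    (h : (Fin n → ℝ) → Fin p → ℝ) (κ : ℕ) (z : (Fin n → ℝ) × (Fin n → ℝ)) : Prop :=
  z ∈ ZSet g h κ ∧
    ∃ r > (0 : ℝ), ∀ z' ∈ ZSet g h κ, dist z' z < r → z'.1 ≠ z.1 → f z.1 < f z'.1

/-- Feasible set `Z(t)` of the Scholtes-type regularized program NLP(t). -/
def ZReg {n m p : ℕ} (g : (Fin n → ℝ) → Fin m → ℝ) (h : (Fin n → ℝ) → Fin p → ℝ)
    (κ : ℕ) (t : ℝ) : Set ((Fin n → ℝ) × (Fin n → ℝ)) :=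
  {z | (∀ i, g z.1 i ≤ 0) ∧ (∀ i, h z.1 i = 0) ∧ (∀ i, 0 ≤ z.2 i) ∧ (∀ i, z.2 i ≤ 1) ∧
    ((n : ℝ) - (κ : ℝ) ≤ ∑ i, z.2 i) ∧ (∀ i, z.1 i * z.2 i ≤ t) ∧ ∀ i, -t ≤ z.1 i * z.2 i}

/-- `z` is a local minimum of the regularized program NLP(t). -/
def LocalMinReg {n m p : ℕ} (f : (Fin n → ℝ) → ℝ) (g : (Fin n → ℝ) → Fin m → ℝ)
    (h : (Fin n → ℝ) → Fin p → ℝ) (κ : ℕ) (t : ℝ) (z : (Fin n → ℝ) × (Fin n → ℝ)) : Prop :=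
  z ∈ ZReg g h κ t ∧ ∃ r > (0 : ℝ), ∀ z' ∈ ZReg g h κ t, dist z' z < r → f z.1 ≤ f z'.1

/-- `z` is a KKT point of the regularized program NLP(t). -/
def KKTReg {n m p : ℕ} (f : (Fin n → ℝ) → ℝ) (g : (Fin n → ℝ) → Fin m → ℝ)
    (h : (Fin n → ℝ) → Fin p → ℝ) (κ : ℕ) (t : ℝ) (z : (Fin n → ℝ) × (Fin n → ℝ)) : Prop :=
  z ∈ ZReg g h κ t ∧
  ∃ (lam : Fin m → ℝ) (mu : Fin p → ℝ) (nu0 nu1 : Fin n → ℝ) (rho : ℝ) (dpl dmi : Fin n → ℝ),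
    (∀ d : Fin n → ℝ, D1 f z.1 d + ∑ i, lam i * D1 (fun x' => g x' i) z.1 d
        + ∑ i, mu i * D1 (fun x' => h x' i) z.1 d
        + ∑ i, (dpl i - dmi i) * z.2 i * d i = 0) ∧
    (∀ i, -nu0 i + nu1 i - rho + (dpl i - dmi i) * z.1 i = 0) ∧
    (∀ i, 0 ≤ lam i) ∧ (∀ i, 0 ≤ nu0 i) ∧ (∀ i, 0 ≤ nu1 i) ∧ 0 ≤ rho ∧
    (∀ i, 0 ≤ dpl i) ∧ (∀ i, 0 ≤ dmi i) ∧
    (∀ i, lam i * g z.1 i = 0) ∧ (∀ i, nu0 i * z.2 i = 0) ∧ (∀ i, nu1 i * (z.2 i - 1) = 0) ∧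
    rho * (∑ i, z.2 i - ((n : ℝ) - (κ : ℝ))) = 0 ∧
    (∀ i, dpl i * (z.1 i * z.2 i - t) = 0) ∧ (∀ i, dmi i * (z.1 i * z.2 i + t) = 0)

/-- Standard MFCQ for the regularized program NLP(t) at a feasible point `z`. -/
def MFCQReg {n m p : ℕ} (g : (Fin n → ℝ) → Fin m → ℝ) (h : (Fin n → ℝ) → Fin p → ℝ)
    (κ : ℕ) (t : ℝ) (z : (Fin n → ℝ) × (Fin n → ℝ)) : Prop :=
  (∀ mu : Fin p → ℝ, (∀ d, ∑ i, mu i * D1 (fun x' => h x' i) z.1 d = 0) → mu = 0) ∧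
  ∃ dx dy : Fin n → ℝ,
    (∀ i, D1 (fun x' => h x' i) z.1 dx = 0) ∧
    (∀ i, g z.1 i = 0 → D1 (fun x' => g x' i) z.1 dx < 0) ∧
    (∀ i, z.2 i = 0 → 0 < dy i) ∧
    (∀ i, z.2 i = 1 → dy i < 0) ∧
    (∑ i, z.2 i = (n : ℝ) - (κ : ℝ) → 0 < ∑ i, dy i) ∧
    (∀ i, z.1 i * z.2 i = t → z.2 i * dx i + z.1 i * dy i < 0) ∧
    (∀ i, z.1 i * z.2 i = -t → 0 < z.2 i * dx i + z.1 i * dy i)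

/-- A sequence of nonzero vectors has a subsequence whose normalizations converge. -/
lemma exists_subseq_tendsto_normalize {W : Type*} [NormedAddCommGroup W] [NormedSpace ℝ W]
    [ProperSpace W] (w : ℕ → W) (hw : ∀ k, w k ≠ 0) :
    ∃ w₀ : W, ‖w₀‖ = 1 ∧ ∃ φ : ℕ → ℕ, StrictMono φ ∧
      Tendsto (fun k => ‖w (φ k)‖⁻¹ • w (φ k)) atTop (𝓝 w₀) := by
  have hmem : ∀ k, ‖w k‖⁻¹ • w k ∈ Metric.sphere (0 : W) 1 := fun k => by
    rw [mem_sphere_zero_iff_norm, norm_smul, norm_inv, norm_norm,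
      inv_mul_cancel₀ (norm_ne_zero_iff.2 (hw k))]
  obtain ⟨w₀, hw₀, φ, hφ, hlim⟩ := (isCompact_sphere (0 : W) 1).tendsto_subseq hmem
  exact ⟨w₀, by simpa using hw₀, φ, hφ, hlim⟩

lemma hasDerivAt_max_zero_sq (s : ℝ) :
    HasDerivAt (fun s : ℝ => (max s 0) ^ 2) (2 * max s 0) s := by
  rcases lt_trichotomy s 0 with hs | rfl | hs
  · rw [max_eq_right hs.le, mul_zero]
    refine (hasDerivAt_const s (0 : ℝ)).congr_of_eventuallyEq ?_
    filter_upwards [eventually_lt_nhds hs] with u hu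
    simp [max_eq_right hu.le]
  · rw [max_self, mul_zero, hasDerivAt_iff_isLittleO]
    have hsq : (fun u : ℝ => u ^ 2) =o[𝓝 0] fun u => u := by
      simpa using Asymptotics.isLittleO_pow_id (𝕜 := ℝ) (n := 2) (by norm_num)
    refine (Asymptotics.IsBigO.of_bound 1 (Eventually.of_forall fun u => ?_)).trans_isLittleO
      (by simpa using hsq)
    rcases le_total u 0 with hu | hu <;> simp [hu, sq_nonneg]
  · rw [max_eq_left hs.le]
    have hd : HasDerivAt (fun u : ℝ => u ^ 2) (2 * s) s := by simpa using hasDerivAt_pow 2 s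
    refine hd.congr_of_eventuallyEq ?_
    filter_upwards [eventually_gt_nhds hs] with u hu
    rw [max_eq_left hu.le]

/-- Fritz John conditions at a strict local minimum of a smooth nonlinear program. -/
theorem fritzJohn_of_strictLocalMin {E ι ι' : Type*} [NormedAddCommGroup E] [NormedSpace ℝ E]
    [ProperSpace E] [Fintype ι] [Fintype ι'] {F : E → ℝ} {G : ι → E → ℝ} {H : ι' → E → ℝ}
    (hF : ContDiff ℝ 1 F) (hG : ∀ i, ContDiff ℝ 1 (G i)) (hH : ∀ i, ContDiff ℝ 1 (H i))
    {a : E} {ε : ℝ} (hε : 0 < ε) (hGa : ∀ i, G i a ≤ 0) (hHa : ∀ i, H i a = 0)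
    (hmin : ∀ z ∈ Metric.closedBall a ε, (∀ i, G i z ≤ 0) → (∀ i, H i z = 0) → z ≠ a →
      F a < F z) :
    ∃ w : ℝ × (ι → ℝ) × (ι' → ℝ), w ≠ 0 ∧ 0 ≤ w.1 ∧ (∀ i, 0 ≤ w.2.1 i) ∧
      (∀ i, w.2.1 i * G i a = 0) ∧
      ∀ d, w.1 * fderiv ℝ F a d + ∑ i, w.2.1 i * fderiv ℝ (G i) a d
        + ∑ i, w.2.2 i * fderiv ℝ (H i) a d = 0 := by
  set pen : E → ℝ := fun z => ∑ i, (max (G i z) 0) ^ 2 + ∑ i, (H i z) ^ 2 with hpen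
  have hpc : Continuous pen := by
    have := fun i => (hG i).continuous
    have := fun i => (hH i).continuous
    fun_prop
  have hpa : pen a = 0 := by simp [hpen, hHa, hGa]
  have hp0 : ∀ z, 0 ≤ pen z := fun z => by positivity
  have hex : ∀ k : ℕ, ∃ z ∈ Metric.closedBall a ε, ∀ z' ∈ Metric.closedBall a ε,
      F z + ((k : ℝ) + 1) * pen z ≤ F z' + ((k : ℝ) + 1) * pen z' := fun k =>
    (isCompact_closedBall a ε).exists_isMinOn ⟨a, Metric.mem_closedBall_self hε.le⟩
      (hF.continuous.add (continuous_const.mul hpc)).continuousOn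
  choose z hzb hzm using hex
  obtain ⟨zb, hzb', φ, hφ, hlim⟩ := (isCompact_closedBall a ε).tendsto_subseq hzb
  have hle : ∀ k, F (z k) + ((k : ℝ) + 1) * pen (z k) ≤ F a := fun k => by
    simpa [hpa] using hzm k a (Metric.mem_closedBall_self hε.le)
  have hFlim : Tendsto (fun k => F (z (φ k))) atTop (𝓝 (F zb)) :=
    (hF.continuous.tendsto zb).comp hlim
  have hFzb : F zb ≤ F a := by
    refine le_of_tendsto hFlim (Eventually.of_forall fun k => ?_)
    have := hle (φ k)
    have := mul_nonneg (by positivity : (0 : ℝ) ≤ (φ k : ℝ) + 1) (hp0 (z (φ k)))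
    linarith
  have hpzb : pen zb = 0 := by
    have h1 : Tendsto (fun k => pen (z (φ k))) atTop (𝓝 (pen zb)) := (hpc.tendsto zb).comp hlim
    have h2 : Tendsto (fun k : ℕ => (1 / ((φ k : ℝ) + 1)) * (F a - F (z (φ k)))) atTop
        (𝓝 (0 * (F a - F zb))) :=
      (tendsto_one_div_add_atTop_nhds_zero_nat.comp hφ.tendsto_atTop).mul
        (tendsto_const_nhds.sub hFlim)
    refine le_antisymm ?_ (hp0 zb)
    rw [zero_mul] at h2
    refine le_of_tendsto_of_tendsto' h1 h2 fun k => ?_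
    have := hle (φ k)
    rw [one_div, ← div_eq_inv_mul, le_div_iff₀ (by positivity)]
    linarith
  have hzba : zb = a := by
    by_contra hne
    have hsum := (add_eq_zero_iff_of_nonneg (Finset.sum_nonneg fun i _ => sq_nonneg _)
      (Finset.sum_nonneg fun i _ => sq_nonneg _)).1 hpzb
    have hg0 := (Finset.sum_eq_zero_iff_of_nonneg fun i _ => sq_nonneg _).1 hsum.1
    have hh0 := (Finset.sum_eq_zero_iff_of_nonneg fun i _ => sq_nonneg _).1 hsum.2
    refine (hmin zb hzb' (fun i => ?_) (fun i => ?_) hne).not_ge hFzb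
    · have := hg0 i (Finset.mem_univ i)
      simpa using this
    · have := hh0 i (Finset.mem_univ i)
      simpa using this
  subst hzba
  set m : ℕ → ℝ × (ι → ℝ) × (ι' → ℝ) := fun k =>
    (1, fun i => ((φ k : ℝ) + 1) * (2 * max (G i (z (φ k))) 0),
      fun i => ((φ k : ℝ) + 1) * (2 * H i (z (φ k)))) with hm
  have hm0 : ∀ k, m k ≠ 0 := fun k hk => one_ne_zero (α := ℝ) (congrArg Prod.fst hk)
  obtain ⟨w, hw1, ψ, hψ, hwlim⟩ := exists_subseq_tendsto_normalize m hm0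
  have hzlim : Tendsto (fun k => z (φ (ψ k))) atTop (𝓝 zb) := hlim.comp hψ.tendsto_atTop
  have hcoord : ∀ i, Tendsto (fun k => (‖m (ψ k)‖⁻¹ • m (ψ k)).2.1 i) atTop (𝓝 (w.2.1 i)) :=
    fun i => ((by fun_prop : Continuous fun w : ℝ × (ι → ℝ) × (ι' → ℝ) => w.2.1 i).tendsto
      w).comp hwlim
  refine ⟨w, fun h0 => by simp [h0] at hw1, ?_, fun i => ?_, fun i => ?_, fun d => ?_⟩
  · refine ge_of_tendsto ((continuous_fst.tendsto w).comp hwlim) (Eventually.of_forall fun k => ?_)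
    simp [hm]
  · refine ge_of_tendsto (hcoord i) (Eventually.of_forall fun k => ?_)
    simp only [hm, Prod.smul_snd, Prod.smul_fst, Pi.smul_apply, smul_eq_mul]
    positivity
  · rcases (hGa i).lt_or_eq with hi | hi
    · have hev : ∀ᶠ k in atTop, G i (z (φ (ψ k))) < 0 :=
        (((hG i).continuous.tendsto zb).comp hzlim).eventually_lt_const hi
      have : w.2.1 i = 0 := by
        refine tendsto_nhds_unique (hcoord i) (tendsto_const_nhds.congr' ?_)
        filter_upwards [hev] with k hk
        simp [hm, max_eq_right hk.le]
      rw [this, zero_mul]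
    · rw [hi, mul_zero]
  · have hcont : Continuous fun q : E × ℝ × (ι → ℝ) × (ι' → ℝ) =>
        q.2.1 * fderiv ℝ F q.1 d + ∑ i, q.2.2.1 i * fderiv ℝ (G i) q.1 d
          + ∑ i, q.2.2.2 i * fderiv ℝ (H i) q.1 d := by
      have h1 := hF.continuous_fderiv one_ne_zero
      have h2 := fun i => (hG i).continuous_fderiv one_ne_zero
      have h3 := fun i => (hH i).continuous_fderiv one_ne_zero
      fun_prop
    refine tendsto_nhds_unique ((hcont.tendsto (zb, w)).comp (hzlim.prodMk_nhds hwlim))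
      (tendsto_const_nhds.congr' ?_)
    filter_upwards [hzlim (Metric.ball_mem_nhds zb hε)] with k hk
    have hloc : IsLocalMin (fun x => F x + ((φ (ψ k) : ℝ) + 1) * pen x) (z (φ (ψ k))) := by
      filter_upwards [Metric.isOpen_ball.mem_nhds hk] with x hx
      exact hzm _ x (Metric.ball_subset_closedBall hx)
    have hD := fun {f : E → ℝ} (hf : ContDiff ℝ 1 f) (x : E) =>
      ((hf.differentiable one_ne_zero) x).hasFDerivAt
    have hder : HasFDerivAt (fun x => F x + ((φ (ψ k) : ℝ) + 1) * pen x)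
        (fderiv ℝ F (z (φ (ψ k))) + ((φ (ψ k) : ℝ) + 1) •
          (∑ i, (2 * max (G i (z (φ (ψ k)))) 0) • fderiv ℝ (G i) (z (φ (ψ k)))
          + ∑ i, (2 * H i (z (φ (ψ k)))) • fderiv ℝ (H i) (z (φ (ψ k))))) (z (φ (ψ k))) := by
      refine (hD hF _).add (HasFDerivAt.const_mul (HasFDerivAt.add ?_ ?_) _)
      · refine HasFDerivAt.fun_sum fun i _ => ?_
        exact (hasDerivAt_max_zero_sq (G i (z (φ (ψ k))))).comp_hasFDerivAt _ (hD (hG i) _)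
      · refine HasFDerivAt.fun_sum fun i _ => ?_
        simpa using (hD (hH i) _).pow 2
    have hz := congrArg (fun L : E →L[ℝ] ℝ => ‖m (ψ k)‖⁻¹ * L d)
      (hloc.hasFDerivAt_eq_zero hder)
    simp only [add_apply, smul_apply, sum_apply, smul_eq_mul, zero_apply, mul_zero] at hz
    rw [← hz]
    simp only [Function.comp_apply]
    generalize ‖m (ψ k)‖⁻¹ = s
    simp only [hm, Prod.smul_fst, Prod.smul_snd, Pi.smul_apply, smul_eq_mul,
      mul_add, Finset.mul_sum, mul_assoc, one_mul]
    ring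

/-- The directional derivative in direction `d` of the generalized Lagrangian with multipliers
`w = (λ₀, λ, μ, γ)`. -/
def lagDeriv {n m p : ℕ} (f : (Fin n → ℝ) → ℝ) (g : (Fin n → ℝ) → Fin m → ℝ)
    (h : (Fin n → ℝ) → Fin p → ℝ) (x : Fin n → ℝ)
    (w : ℝ × (Fin m → ℝ) × (Fin p → ℝ) × (Fin n → ℝ)) (d : Fin n → ℝ) : ℝ :=
  w.1 * D1 f x d + ∑ i, w.2.1 i * D1 (fun x' => g x' i) x d
    + ∑ i, w.2.2.1 i * D1 (fun x' => h x' i) x d + ∑ i, w.2.2.2 i * d i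

/-- Fritz John multipliers at `x` for the nonlinear program in which the components of `x`
vanishing at `xs` are fixed to zero. -/
structure IsTightFJMult {n m p : ℕ} (f : (Fin n → ℝ) → ℝ) (g : (Fin n → ℝ) → Fin m → ℝ)
    (h : (Fin n → ℝ) → Fin p → ℝ) (xs x : Fin n → ℝ)
    (w : ℝ × (Fin m → ℝ) × (Fin p → ℝ) × (Fin n → ℝ)) : Prop where
  stat : ∀ d, lagDeriv f g h x w d = 0
  obj_nonneg : 0 ≤ w.1
  lam_nonneg : ∀ i, 0 ≤ w.2.1 i
  compl : ∀ i, w.2.1 i * g x i = 0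
  gam_eq_zero : ∀ i, xs i ≠ 0 → w.2.2.2 i = 0

/-- Fritz John multipliers `w = (λ₀, λ, μ, γ)` for the regularized program, where `γ` collects the
contribution of the constraints `-t ≤ xᵢ yᵢ ≤ t` to the gradient with respect to `x`. -/
def IsRegFJMult {n m p : ℕ} (f : (Fin n → ℝ) → ℝ) (g : (Fin n → ℝ) → Fin m → ℝ)
    (h : (Fin n → ℝ) → Fin p → ℝ) (κ : ℕ) (t : ℝ) (z : (Fin n → ℝ) × (Fin n → ℝ))
    (w : ℝ × (Fin m → ℝ) × (Fin p → ℝ) × (Fin n → ℝ)) : Prop :=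
  (∀ d, lagDeriv f g h z.1 w d = 0) ∧ 0 ≤ w.1 ∧ (∀ i, 0 ≤ w.2.1 i) ∧
    (∀ i, w.2.1 i * g z.1 i = 0) ∧
    ∃ (nu0 nu1 : Fin n → ℝ) (rho : ℝ) (dpl dmi : Fin n → ℝ),
      (∀ i, w.2.2.2 i = (dpl i - dmi i) * z.2 i) ∧
      (∀ i, -nu0 i + nu1 i - rho + (dpl i - dmi i) * z.1 i = 0) ∧
      (∀ i, 0 ≤ nu0 i) ∧ (∀ i, 0 ≤ nu1 i) ∧ 0 ≤ rho ∧
      (∀ i, 0 ≤ dpl i) ∧ (∀ i, 0 ≤ dmi i) ∧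
      (∀ i, nu0 i * z.2 i = 0) ∧ (∀ i, nu1 i * (z.2 i - 1) = 0) ∧
      rho * (∑ i, z.2 i - ((n : ℝ) - (κ : ℝ))) = 0 ∧
      (∀ i, dpl i * (z.1 i * z.2 i - t) = 0) ∧ (∀ i, dmi i * (z.1 i * z.2 i + t) = 0)

section
variable {n m p : ℕ} {f : (Fin n → ℝ) → ℝ} {g : (Fin n → ℝ) → Fin m → ℝ}
  {h : (Fin n → ℝ) → Fin p → ℝ} {κ : ℕ} {xs : Fin n → ℝ}

lemma continuous_D1_apply {φ : (Fin n → ℝ) → ℝ} (hφ : ContDiff ℝ 1 φ) (d : Fin n → ℝ) :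
    Continuous fun x => D1 φ x d := by
  have := hφ.continuous_fderiv one_ne_zero
  unfold D1
  fun_prop

lemma continuous_lagDeriv (hf : ContDiff ℝ 1 f) (hg : ∀ i, ContDiff ℝ 1 (fun x => g x i))
    (hh : ∀ i, ContDiff ℝ 1 (fun x => h x i)) (d : Fin n → ℝ) :
    Continuous fun q : (Fin n → ℝ) × ℝ × (Fin m → ℝ) × (Fin p → ℝ) × (Fin n → ℝ) =>
      lagDeriv f g h q.1 q.2 d := by
  have h1 := continuous_D1_apply hf d
  have h2 := fun i => continuous_D1_apply (hg i) d
  have h3 := fun i => continuous_D1_apply (hh i) d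
  unfold lagDeriv
  fun_prop

lemma lagDeriv_smul (c : ℝ) (x : Fin n → ℝ) (w : ℝ × (Fin m → ℝ) × (Fin p → ℝ) × (Fin n → ℝ))
    (d : Fin n → ℝ) : lagDeriv f g h x (c • w) d = c * lagDeriv f g h x w d := by
  simp only [lagDeriv, Prod.smul_fst, Prod.smul_snd, Pi.smul_apply, smul_eq_mul, mul_add,
    Finset.mul_sum, mul_assoc]

lemma IsTightFJMult.smul {x : Fin n → ℝ} {w : ℝ × (Fin m → ℝ) × (Fin p → ℝ) × (Fin n → ℝ)}
    (hw : IsTightFJMult f g h xs x w) {c : ℝ} (hc : 0 ≤ c) :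
    IsTightFJMult f g h xs x (c • w) where
  stat d := by rw [lagDeriv_smul, hw.stat, mul_zero]
  obj_nonneg := mul_nonneg hc hw.obj_nonneg
  lam_nonneg i := mul_nonneg hc (hw.lam_nonneg i)
  compl i := by
    simp only [Prod.smul_fst, Prod.smul_snd, Pi.smul_apply, smul_eq_mul, mul_assoc, hw.compl i,
      mul_zero]
  gam_eq_zero i hi := by simp [hw.gam_eq_zero i hi]

/-- CC-MFCQ forces the objective multiplier of tightened Fritz John multipliers to be positive. -/
lemma IsTightFJMult.obj_pos {w : ℝ × (Fin m → ℝ) × (Fin p → ℝ) × (Fin n → ℝ)}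
    (hw : IsTightFJMult f g h xs xs w) (hmfcq : CCMFCQ g h xs) (hw0 : w ≠ 0) : 0 < w.1 := by
  refine hw.obj_nonneg.lt_of_ne fun h0 => hw0 ?_
  obtain ⟨h1, h2, h3⟩ := hmfcq w.2.1 w.2.2.1 w.2.2.2 hw.lam_nonneg
    (fun i hi => (mul_eq_zero.1 (hw.compl i)).resolve_right hi) hw.gam_eq_zero
    (fun d => by simpa [lagDeriv, ← h0] using hw.stat d)
  exact Prod.ext h0.symm (Prod.ext h1 (Prod.ext h2 h3))

lemma exists_pos_le_abs (xs : Fin n → ℝ) :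
    ∃ c > 0, ∀ x, dist x xs ≤ c → ∀ i, xs i ≠ 0 → c ≤ |x i| := by
  have hev : ∀ᶠ c in 𝓝[>] (0 : ℝ), ∀ i, xs i ≠ 0 → c + c ≤ |xs i| := by
    rw [eventually_all]
    intro i
    by_cases hi : xs i = 0
    · simp [hi]
    · have hlim : Tendsto (fun c : ℝ => c + c) (𝓝[>] 0) (𝓝 (0 + 0)) :=
        ((continuous_id.add continuous_id).tendsto (0 : ℝ)).mono_left nhdsWithin_le_nhds
      filter_upwards [hlim.eventually_lt_const
        (by simpa using hi : (0 : ℝ) + 0 < |xs i|)] with c hc _ using hc.le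
  obtain ⟨c, hc, hc0⟩ := (hev.and self_mem_nhdsWithin).exists
  refine ⟨c, hc0, fun x hx i hi => ?_⟩
  have h1 := (dist_le_pi_dist x xs i).trans hx
  rw [Real.dist_eq] at h1
  have h2 := abs_sub_abs_le_abs_sub (xs i) (x i)
  rw [abs_sub_comm] at h2
  linarith [hc i hi]

lemma card0_eq_sum (xs : Fin n → ℝ) :
    ∑ i, (if xs i = 0 then (1 : ℝ) else 0) = (n : ℝ) - card0 xs := by
  classical
  have h1 : ∑ i, (if xs i = 0 then (1 : ℝ) else 0) + ∑ i, (if xs i ≠ 0 then (1 : ℝ) else 0)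
      = n := by
    rw [← Finset.sum_add_distrib, Finset.sum_congr rfl (g := fun _ => (1 : ℝ))]
    · simp
    · intro i _
      by_cases hi : xs i = 0 <;> simp [hi]
  have h2 : ∑ i, (if xs i ≠ 0 then (1 : ℝ) else 0) = card0 xs := by
    rw [Finset.sum_boole, card0, Set.ncard_eq_toFinset_card']
    simp
  linarith

/-- For points of the regularized feasible set whose `x`-part is bounded away from zero on the
support of `xs`, the `y`-part is close to the indicator of the zero set of `xs`. -/
lemma abs_sub_indicator_le {t c : ℝ} (hc : 0 < c) (ht : 0 ≤ t) (hcard : card0 xs = κ)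
    {z : (Fin n → ℝ) × (Fin n → ℝ)} (hz : z ∈ ZReg g h κ t)
    (hzc : ∀ i, xs i ≠ 0 → c ≤ |z.1 i|) (i : Fin n) :
    |z.2 i - if xs i = 0 then 1 else 0| ≤ n * (t / c) := by
  obtain ⟨-, -, hy0, hy1, hsum, hup, hlo⟩ := hz
  have hn1 : (1 : ℝ) ≤ n := by
    have : 0 < n := i.pos
    exact_mod_cast this
  have htc : 0 ≤ t / c := div_nonneg ht hc.le
  have hsupp : ∀ j, xs j ≠ 0 → z.2 j ≤ t / c := fun j hj => by
    rw [le_div_iff₀ hc]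
    calc z.2 j * c ≤ z.2 j * |z.1 j| := mul_le_mul_of_nonneg_left (hzc j hj) (hy0 j)
      _ = |z.1 j * z.2 j| := by rw [abs_mul, abs_of_nonneg (hy0 j), mul_comm]
      _ ≤ t := abs_le.2 ⟨hlo j, hup j⟩
  by_cases hi : xs i = 0
  · have h1 : ∑ j, ((if xs j = 0 then (1 : ℝ) else 0) - z.2 j) ≤ 0 := by
      rw [Finset.sum_sub_distrib, card0_eq_sum, hcard]
      linarith
    have h2 : ∑ j, ((if xs j = 0 then (1 : ℝ) else 0) - z.2 j + t / c) ≤ n * (t / c) := by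
      rw [Finset.sum_add_distrib]
      simpa using h1
    have h3 := Finset.single_le_sum
      (f := fun j => (if xs j = 0 then (1 : ℝ) else 0) - z.2 j + t / c)
      (s := Finset.univ) (fun j _ => by
        by_cases hj : xs j = 0
        · simp only [hj, if_true]
          linarith [hy1 j]
        · simp only [hj, if_false]
          linarith [hsupp j hj]) (Finset.mem_univ i)
    simp only [hi, if_true] at h3 ⊢
    rw [abs_le]
    constructor <;> nlinarith [hy1 i]
  · simp only [hi, if_false, sub_zero, abs_of_nonneg (hy0 i)]
    nlinarith [hsupp i hi]

/-- Off the support of `xs`, the `x`-part of such points is of order `t`. -/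
lemma abs_le_two_mul_of_mem_ZReg {t c : ℝ} (hc : 0 < c) (ht : 0 ≤ t) (hcard : card0 xs = κ)
    (htc : n * (t / c) ≤ 1 / 2)
    {z : (Fin n → ℝ) × (Fin n → ℝ)} (hz : z ∈ ZReg g h κ t)
    (hzc : ∀ i, xs i ≠ 0 → c ≤ |z.1 i|) {i : Fin n} (hi : xs i = 0) : |z.1 i| ≤ 2 * t := by
  have h1 := abs_le.1 ((abs_sub_indicator_le hc ht hcard hz hzc i).trans htc)
  rw [if_pos hi] at h1
  obtain ⟨-, -, hy0, hy1, hsum, hup, hlo⟩ := hz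
  have h2 : |z.1 i| * z.2 i ≤ t := by
    rw [← abs_of_nonneg (hy0 i), ← abs_mul]
    exact abs_le.2 ⟨hlo i, hup i⟩
  nlinarith [abs_nonneg (z.1 i)]

/-- On the support of `xs` the multipliers `γ` are of order `t²` relative to `‖γ‖`. -/
lemma IsRegFJMult.abs_gam_le {t c : ℝ} (hc : 0 < c) (ht : 0 < t) (hcard : card0 xs = κ)
    (htc : n * (t / c) ≤ 1 / 2)
    {z : (Fin n → ℝ) × (Fin n → ℝ)} (hz : z ∈ ZReg g h κ t)
    (hzc : ∀ i, xs i ≠ 0 → c ≤ |z.1 i|)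
    {w : ℝ × (Fin m → ℝ) × (Fin p → ℝ) × (Fin n → ℝ)} (hw : IsRegFJMult f g h κ t z w)
    {i : Fin n} (hi : xs i ≠ 0) : |w.2.2.2 i| ≤ 4 * t ^ 2 / c ^ 2 * ‖w.2.2.2‖ := by
  have hy := fun j => abs_le.1 ((abs_sub_indicator_le hc ht.le hcard hz hzc j).trans htc)
  obtain ⟨-, -, -, -, nu0, nu1, rho, dpl, dmi, hgam, hstat, hnu0, hnu1, hrho, hdpl, hdmi, hc0,
    hc1, hcr, hcp, hcm⟩ := hw
  obtain ⟨-, -, hy0, hy1, hsum, hup, hlo⟩ := hz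
  have hrhs : 0 ≤ 4 * t ^ 2 / c ^ 2 * ‖w.2.2.2‖ := by positivity
  have hact : ∀ j, dpl j - dmi j ≠ 0 → |z.1 j| * z.2 j = t := fun j hj => by
    rw [← abs_of_nonneg (hy0 j), ← abs_mul]
    rcases mul_eq_zero.1 (hcp j) with h1 | h1
    · rcases mul_eq_zero.1 (hcm j) with h2 | h2
      · exact absurd (by rw [h1, h2, sub_zero]) hj
      · rw [eq_neg_of_add_eq_zero_left h2, abs_neg, abs_of_pos ht]
    · rw [sub_eq_zero.1 h1, abs_of_pos ht]
  by_cases hgi : w.2.2.2 i = 0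
  · rwa [hgi, abs_zero]
  rw [hgam] at hgi
  have hδi : dpl i - dmi i ≠ 0 := left_ne_zero_of_mul hgi
  have hyi : z.2 i ≠ 0 := right_ne_zero_of_mul hgi
  have hyi' : 0 < z.2 i := (hy0 i).lt_of_ne' hyi
  have hnu0i : nu0 i = 0 := (mul_eq_zero.1 (hc0 i)).resolve_right hyi
  have hyi1 : z.2 i ≤ 1 / 2 := by
    have := (hy i).2
    rwa [if_neg hi, sub_zero] at this
  have hnu1i : nu1 i = 0 := (mul_eq_zero.1 (hc1 i)).resolve_right (by linarith)
  have hxi : 0 < |z.1 i| := hc.trans_le (hzc i hi)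
  have hρi : |dpl i - dmi i| * |z.1 i| = rho := by
    rw [← abs_mul, ← abs_of_nonneg hrho]
    congr 1
    linarith [hstat i]
  have hrho' : 0 < rho := by
    rw [← hρi]
    exact mul_pos (abs_pos.2 hδi) hxi
  have hsum' : ∑ j, z.2 j = n - κ := by
    have := (mul_eq_zero.1 hcr).resolve_left hrho'.ne'
    linarith
  obtain ⟨j, hj, hyj⟩ : ∃ j, xs j = 0 ∧ z.2 j < 1 := by
    by_contra! hcon
    have : ∑ j, (if xs j = 0 then (1 : ℝ) else 0) < ∑ j, z.2 j := by
      refine Finset.sum_lt_sum (fun j _ => ?_) ⟨i, Finset.mem_univ i, by rwa [if_neg hi]⟩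
      by_cases hj : xs j = 0
      · rw [if_pos hj]
        exact hcon j hj
      · rw [if_neg hj]
        exact hy0 j
    rw [card0_eq_sum, hcard, hsum'] at this
    exact lt_irrefl _ this
  have hyj2 : 1 / 2 ≤ z.2 j := by
    have := (hy j).1
    rw [if_pos hj] at this
    linarith
  have hnu0j : nu0 j = 0 := (mul_eq_zero.1 (hc0 j)).resolve_right (by linarith)
  have hnu1j : nu1 j = 0 := (mul_eq_zero.1 (hc1 j)).resolve_right (by linarith)
  have hρj : |dpl j - dmi j| * |z.1 j| = rho := by
    rw [← abs_mul, ← abs_of_nonneg hrho]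
    congr 1
    linarith [hstat j]
  have hδj : dpl j - dmi j ≠ 0 := fun h0 => by
    rw [h0, abs_zero, zero_mul] at hρj
    exact hrho'.ne hρj
  have hgj : |w.2.2.2 j| = |dpl j - dmi j| * z.2 j := by
    rw [hgam, abs_mul, abs_of_nonneg (hy0 j)]
  have hρle : rho ≤ 4 * t * ‖w.2.2.2‖ := by
    have h1 : |dpl j - dmi j| * z.2 j ≤ ‖w.2.2.2‖ := hgj ▸ norm_le_pi_norm w.2.2.2 j
    have h2 : rho * z.2 j = t * |dpl j - dmi j| := by
      rw [← hρj, ← hact j hδj]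
      ring
    have h3 : |dpl j - dmi j| ≤ 2 * ‖w.2.2.2‖ := by nlinarith [abs_nonneg (dpl j - dmi j)]
    nlinarith [mul_le_mul_of_nonneg_left h3 ht.le]
  have hgi' : |w.2.2.2 i| * |z.1 i| ^ 2 = rho * t := by
    rw [hgam, abs_mul, abs_of_nonneg (hy0 i), ← hρi, ← hact i hδi]
    ring
  have hle : |w.2.2.2 i| * c ^ 2 ≤ rho * t := by
    rw [← hgi']
    gcongr
    exact hzc i hi
  rw [div_mul_eq_mul_div, le_div_iff₀ (by positivity)]
  nlinarith [mul_le_mul_of_nonneg_right hρle ht.le]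

end

section
variable {n m p : ℕ} {f : (Fin n → ℝ) → ℝ} {g : (Fin n → ℝ) → Fin m → ℝ}
  {h : (Fin n → ℝ) → Fin p → ℝ} {κ : ℕ} {xs : Fin n → ℝ}

/-- Limits of points of the regularized feasible sets lie in the feasible set of the program in
which the components outside the support of `xs` are fixed to zero. -/
lemma feasible_of_tendsto (hg : ∀ i, Continuous (fun x => g x i))
    (hh : ∀ i, Continuous (fun x => h x i)) {c : ℝ} (hc : 0 < c) (hcard : card0 xs = κ)
    {t : ℕ → ℝ} (ht : ∀ k, 0 < t k) (htl : Tendsto t atTop (𝓝 0))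
    {z : ℕ → (Fin n → ℝ) × (Fin n → ℝ)} (hz : ∀ k, z k ∈ ZReg g h κ (t k))
    (hzc : ∀ k i, xs i ≠ 0 → c ≤ |(z k).1 i|) {xb : Fin n → ℝ}
    (hx : Tendsto (fun k => (z k).1) atTop (𝓝 xb)) :
    (∀ i, g xb i ≤ 0) ∧ (∀ i, h xb i = 0) ∧ (∀ i, xs i = 0 → xb i = 0) ∧
      Tendsto (fun k => (z k).2) atTop (𝓝 fun i => if xs i = 0 then 1 else 0) := by
  have hsmall : Tendsto (fun k => n * (t k / c)) atTop (𝓝 0) := by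
    simpa using (htl.div_const c).const_mul (n : ℝ)
  refine ⟨fun i => ?_, fun i => ?_, fun i hi => ?_, ?_⟩
  · exact le_of_tendsto (((hg i).tendsto xb).comp hx) (Eventually.of_forall fun k => (hz k).1 i)
  · exact tendsto_nhds_unique (((hh i).tendsto xb).comp hx)
      (tendsto_const_nhds.congr fun k => ((hz k).2.1 i).symm)
  · have h1 : Tendsto (fun k => (z k).1 i) atTop (𝓝 (xb i)) := (tendsto_pi_nhds.1 hx) i
    refine tendsto_nhds_unique h1 (squeeze_zero_norm' (a := fun k => 2 * t k) ?_
      (by simpa using htl.const_mul 2))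
    filter_upwards [hsmall.eventually_le_const (by norm_num : (0 : ℝ) < 1 / 2)] with k hk
    exact abs_le_two_mul_of_mem_ZReg hc (ht k).le hcard hk (hz k) (hzc k) hi
  · refine tendsto_pi_nhds.2 fun i => ?_
    rw [tendsto_iff_norm_sub_tendsto_zero]
    exact squeeze_zero (fun _ => norm_nonneg _)
      (fun k => abs_sub_indicator_le hc (ht k).le hcard (hz k) (hzc k) i) hsmall

/-- Normalized Fritz John multipliers of the regularized programs accumulate at tightened
Fritz John multipliers of the limit point. -/
lemma exists_isTightFJMult_of_tendsto (hf : ContDiff ℝ 1 f)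
    (hg : ∀ i, ContDiff ℝ 1 (fun x => g x i)) (hh : ∀ i, ContDiff ℝ 1 (fun x => h x i))
    {c : ℝ} (hc : 0 < c) (hcard : card0 xs = κ)
    {t : ℕ → ℝ} (ht : ∀ k, 0 < t k) (htl : Tendsto t atTop (𝓝 0))
    {z : ℕ → (Fin n → ℝ) × (Fin n → ℝ)} (hz : ∀ k, z k ∈ ZReg g h κ (t k))
    (hzc : ∀ k i, xs i ≠ 0 → c ≤ |(z k).1 i|) {xb : Fin n → ℝ}
    (hx : Tendsto (fun k => (z k).1) atTop (𝓝 xb))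
    {w : ℕ → ℝ × (Fin m → ℝ) × (Fin p → ℝ) × (Fin n → ℝ)}
    (hw : ∀ k, IsRegFJMult f g h κ (t k) (z k) (w k)) (hw0 : ∀ k, w k ≠ 0) :
    ∃ w₀, w₀ ≠ 0 ∧ IsTightFJMult f g h xs xb w₀ ∧ ((∀ k, (w k).1 = 0) → w₀.1 = 0) := by
  obtain ⟨w₀, hw1, φ, hφ, hlim⟩ := exists_subseq_tendsto_normalize w hw0
  have hxφ := hx.comp hφ.tendsto_atTop
  have hobj := (continuous_fst.tendsto w₀).comp hlim
  have hlam : ∀ i, Tendsto (fun k => (‖w (φ k)‖⁻¹ • w (φ k)).2.1 i) atTop (𝓝 (w₀.2.1 i)) :=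
    fun i => ((by fun_prop : Continuous
      fun w : ℝ × (Fin m → ℝ) × (Fin p → ℝ) × (Fin n → ℝ) => w.2.1 i).tendsto w₀).comp hlim
  have hgam : ∀ i, Tendsto (fun k => (‖w (φ k)‖⁻¹ • w (φ k)).2.2.2 i) atTop (𝓝 (w₀.2.2.2 i)) :=
    fun i => ((by fun_prop : Continuous
      fun w : ℝ × (Fin m → ℝ) × (Fin p → ℝ) × (Fin n → ℝ) => w.2.2.2 i).tendsto w₀).comp hlim
  refine ⟨w₀, fun h0 => by simp [h0] at hw1, ⟨fun d => ?_, ?_, fun i => ?_, fun i => ?_,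
    fun i hi => ?_⟩, fun h0 => ?_⟩
  · refine tendsto_nhds_unique (((continuous_lagDeriv hf hg hh d).tendsto (xb, w₀)).comp
      (hxφ.prodMk_nhds hlim)) (tendsto_const_nhds.congr fun k => ?_)
    simp only [Function.comp_apply]
    rw [lagDeriv_smul, (hw _).1, mul_zero]
  · exact ge_of_tendsto hobj (Eventually.of_forall fun k =>
      mul_nonneg (by positivity) (hw (φ k)).2.1)
  · exact ge_of_tendsto (hlam i) (Eventually.of_forall fun k =>
      mul_nonneg (by positivity) ((hw (φ k)).2.2.1 i))
  · refine tendsto_nhds_unique ((hlam i).mul (((hg i).continuous.tendsto xb).comp hxφ))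
      (tendsto_const_nhds.congr fun k => ?_)
    simp only [Function.comp_apply, Prod.smul_fst, Prod.smul_snd, Pi.smul_apply, smul_eq_mul,
      mul_assoc, (hw (φ k)).2.2.2.1 i, mul_zero]
  · have htφ := htl.comp hφ.tendsto_atTop
    have hsmall : Tendsto (fun k => n * (t (φ k) / c)) atTop (𝓝 0) := by
      simpa using (htφ.div_const c).const_mul (n : ℝ)
    refine tendsto_nhds_unique (hgam i) (squeeze_zero_norm' (a := fun k => 4 * t (φ k) ^ 2 / c ^ 2)
      ?_ (by simpa using ((htφ.pow 2).const_mul 4).div_const (c ^ 2)))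
    filter_upwards [hsmall.eventually_le_const (by norm_num : (0 : ℝ) < 1 / 2)] with k hk
    have h1 := (hw (φ k)).abs_gam_le hc (ht _) hcard hk (hz _) (hzc _) hi
    have hpos : 0 < ‖w (φ k)‖ := norm_pos_iff.2 (hw0 _)
    have h2 : ‖(w (φ k)).2.2.2‖ ≤ ‖w (φ k)‖ :=
      (norm_snd_le _).trans ((norm_snd_le _).trans (norm_snd_le _))
    simp only [Prod.smul_snd, Pi.smul_apply, norm_smul, norm_inv, norm_norm]
    rw [inv_mul_le_iff₀ hpos, mul_comm]
    exact h1.trans (mul_le_mul_of_nonneg_left h2 (by positivity))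
  · exact tendsto_nhds_unique hobj (tendsto_const_nhds.congr fun k => by simp [h0])

lemma isRegFJMult_aux_eq_zero {t : ℝ} (ht : 0 < t) {x y nu0 nu1 dpl dmi : Fin n → ℝ} {rho : ℝ}
    (hstat : ∀ i, -nu0 i + nu1 i - rho + (dpl i - dmi i) * x i = 0)
    (hnu0 : ∀ i, 0 ≤ nu0 i) (hrho : 0 ≤ rho)
    (hc0 : ∀ i, nu0 i * y i = 0) (hc1 : ∀ i, nu1 i * (y i - 1) = 0)
    (hcp : ∀ i, dpl i * (x i * y i - t) = 0) (hcm : ∀ i, dmi i * (x i * y i + t) = 0)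
    (hgam : ∀ i, (dpl i - dmi i) * y i = 0) (hy : ∃ i, y i ≠ 1) :
    nu0 = 0 ∧ nu1 = 0 ∧ rho = 0 ∧ dpl = 0 ∧ dmi = 0 := by
  have hd : ∀ i, dpl i = 0 ∧ dmi i = 0 := fun i => by
    have hp := mul_eq_zero.1 (hcp i)
    have hm := mul_eq_zero.1 (hcm i)
    rcases mul_eq_zero.1 (hgam i) with h1 | h1
    · rcases hp with hp | hp
      · exact ⟨hp, by linarith⟩
      · rcases hm with hm | hm
        · exact ⟨by linarith, hm⟩
        · linarith
    · rw [h1, mul_zero] at hp hm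
      exact ⟨hp.resolve_right (by linarith), hm.resolve_right (by linarith)⟩
  have hst : ∀ i, nu1 i = nu0 i + rho := fun i => by
    have := hstat i
    rw [(hd i).1, (hd i).2] at this
    linarith
  obtain ⟨i, hi⟩ := hy
  have hr : rho = 0 := by
    have h1 := (mul_eq_zero.1 (hc1 i)).resolve_right (sub_ne_zero.2 hi)
    linarith [hst i, hnu0 i]
  have h0 : ∀ i, nu0 i = 0 := fun i => by
    have h1 := hst i
    rcases mul_eq_zero.1 (hc0 i) with h2 | h2
    · exact h2
    · have := hc1 i
      rw [h2] at this
      linarith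
  exact ⟨funext h0, funext fun i => by simp [hst i, h0 i, hr], hr, funext fun i => (hd i).1,
    funext fun i => (hd i).2⟩

lemma fderiv_comp_fst_apply {φ : (Fin n → ℝ) → ℝ} (hφ : ContDiff ℝ 1 φ)
    (z d : (Fin n → ℝ) × (Fin n → ℝ)) :
    fderiv ℝ (fun z : (Fin n → ℝ) × (Fin n → ℝ) => φ z.1) z d = D1 φ z.1 d.1 := by
  have h1 : HasFDerivAt φ (fderiv ℝ φ z.1) z.1 :=
    (hφ.differentiable one_ne_zero z.1).hasFDerivAt
  exact congrArg (fun L => L d) (h1.comp z hasFDerivAt_fst).fderiv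

/-- Local minima of the regularized program admit nontrivial Fritz John multipliers. -/
lemma exists_isRegFJMult_of_localMin (hf : ContDiff ℝ 1 f)
    (hg : ∀ i, ContDiff ℝ 1 (fun x => g x i)) (hh : ∀ i, ContDiff ℝ 1 (fun x => h x i))
    {t : ℝ} (ht : 0 < t) {z : (Fin n → ℝ) × (Fin n → ℝ)} (hz : z ∈ ZReg g h κ t)
    {ε : ℝ} (hε : 0 < ε)
    (hmin : ∀ z' ∈ ZReg g h κ t, z' ∈ Metric.closedBall z ε → f z.1 ≤ f z'.1)
    (hy : ∃ i, z.2 i ≠ 1) : ∃ w, w ≠ 0 ∧ IsRegFJMult f g h κ t z w := by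
  set q : (Fin n → ℝ) × (Fin n → ℝ) → ℝ := fun z' =>
    ∑ i, (z'.1 i - z.1 i) ^ 2 + ∑ i, (z'.2 i - z.2 i) ^ 2 with hq
  have hqc : ContDiff ℝ 1 q := by fun_prop
  have hqz : q z = 0 := by simp [hq]
  have hq0 : ∀ z', 0 ≤ q z' := fun z' => by positivity
  have hqpos : ∀ z', z' ≠ z → 0 < q z' := fun z' hne => by
    refine (hq0 z').lt_of_ne fun h0 => hne ?_
    have hsum := (add_eq_zero_iff_of_nonneg (Finset.sum_nonneg fun i _ => sq_nonneg _)
      (Finset.sum_nonneg fun i _ => sq_nonneg _)).1 h0.symm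
    have h1 := (Finset.sum_eq_zero_iff_of_nonneg fun i _ => sq_nonneg _).1 hsum.1
    have h2 := (Finset.sum_eq_zero_iff_of_nonneg fun i _ => sq_nonneg _).1 hsum.2
    refine Prod.ext (funext fun i => ?_) (funext fun i => ?_)
    · simpa [sub_eq_zero] using h1 i (Finset.mem_univ i)
    · simpa [sub_eq_zero] using h2 i (Finset.mem_univ i)
  have hfq : ContDiff ℝ 1 fun z' : (Fin n → ℝ) × (Fin n → ℝ) => f z'.1 := hf.comp contDiff_fst
  have hqmin : fderiv ℝ q z = 0 := IsLocalMin.fderiv_eq_zero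
    (Eventually.of_forall fun z' => by rw [hqz]; exact hq0 z')
  have hFd : ∀ d, fderiv ℝ (fun z' => f z'.1 + q z') z d = D1 f z.1 d.1 := fun d => by
    rw [fderiv_fun_add (hfq.differentiable one_ne_zero z) (hqc.differentiable one_ne_zero z),
      hqmin, add_zero, fderiv_comp_fst_apply hf]
  set G : Fin m ⊕ Fin n ⊕ Fin n ⊕ Unit ⊕ Fin n ⊕ Fin n → (Fin n → ℝ) × (Fin n → ℝ) → ℝ :=
    Sum.elim (fun i z => g z.1 i) <| Sum.elim (fun i z => -z.2 i) <|
    Sum.elim (fun i z => z.2 i - 1) <| Sum.elim (fun _ z => (n : ℝ) - κ - ∑ i, z.2 i) <|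
    Sum.elim (fun i z => z.1 i * z.2 i - t) (fun i z => -t - z.1 i * z.2 i) with hG
  have hfeas : ∀ z', (∀ i, G i z' ≤ 0) → (∀ i, h z'.1 i = 0) → z' ∈ ZReg g h κ t := by
    intro z' h1 h2
    simp only [hG, Sum.forall, Sum.elim_inl, Sum.elim_inr] at h1
    obtain ⟨h3, h4, h5, h6, h7, h8⟩ := h1
    exact ⟨h3, h2, fun i => by linarith [h4 i], fun i => by linarith [h5 i], by linarith [h6 ()],
      fun i => by linarith [h7 i], fun i => by linarith [h8 i]⟩
  have hz' := hz
  obtain ⟨hzg, hzh, hy0, hy1, hsum, hup, hlo⟩ := hz'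
  obtain ⟨W, hW0, hWobj, hWlam, hWc, hWs⟩ :=
    fritzJohn_of_strictLocalMin (F := fun z' => f z'.1 + q z') (G := G)
      (H := fun i z' => h z'.1 i) (a := z) (hfq.add hqc) (by
        simp only [hG, Sum.forall, Sum.elim_inl, Sum.elim_inr]
        refine ⟨fun i => (hg i).comp contDiff_fst, ?_, ?_, ?_, ?_, ?_⟩ <;> intro i <;> fun_prop)
      (fun i => (hh i).comp contDiff_fst) hε (by
        simp only [hG, Sum.forall, Sum.elim_inl, Sum.elim_inr]
        exact ⟨hzg, fun i => by linarith [hy0 i], fun i => by linarith [hy1 i],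
          fun _ => by linarith, fun i => by linarith [hup i], fun i => by linarith [hlo i]⟩)
      hzh (fun z' hz'b h1 h2 hne => by
        have h3 := hmin z' (hfeas z' h1 h2) hz'b
        have h4 := hqpos z' hne
        simp only [hqz]
        linarith)
  have hfst : ∀ i, HasFDerivAt (fun z : (Fin n → ℝ) × (Fin n → ℝ) => z.1 i)
      ((ContinuousLinearMap.proj (R := ℝ) (φ := fun _ : Fin n => ℝ) i).comp
        (ContinuousLinearMap.fst ℝ (Fin n → ℝ) (Fin n → ℝ))) z := fun i =>
    ((ContinuousLinearMap.proj (R := ℝ) (φ := fun _ : Fin n => ℝ) i).comp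
      (ContinuousLinearMap.fst ℝ (Fin n → ℝ) (Fin n → ℝ))).hasFDerivAt
  have hsnd : ∀ i, HasFDerivAt (fun z : (Fin n → ℝ) × (Fin n → ℝ) => z.2 i)
      ((ContinuousLinearMap.proj (R := ℝ) (φ := fun _ : Fin n => ℝ) i).comp
        (ContinuousLinearMap.snd ℝ (Fin n → ℝ) (Fin n → ℝ))) z := fun i =>
    ((ContinuousLinearMap.proj (R := ℝ) (φ := fun _ : Fin n => ℝ) i).comp
      (ContinuousLinearMap.snd ℝ (Fin n → ℝ) (Fin n → ℝ))).hasFDerivAt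
  have hd2 : ∀ i d, fderiv ℝ (fun z : (Fin n → ℝ) × (Fin n → ℝ) => -z.2 i) z d = -d.2 i :=
    fun i d => by rw [(hsnd i).fun_neg.fderiv]; simp
  have hd3 : ∀ i d, fderiv ℝ (fun z : (Fin n → ℝ) × (Fin n → ℝ) => z.2 i - 1) z d = d.2 i :=
    fun i d => by rw [((hsnd i).sub_const 1).fderiv]; simp
  have hd4 : ∀ d, fderiv ℝ (fun z : (Fin n → ℝ) × (Fin n → ℝ) =>
      (n : ℝ) - κ - ∑ i, z.2 i) z d = -∑ i, d.2 i := fun d => by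
    rw [((HasFDerivAt.fun_sum fun i (_ : i ∈ Finset.univ) => hsnd i).const_sub _).fderiv]
    simp
  have hd5 : ∀ i d, fderiv ℝ (fun z : (Fin n → ℝ) × (Fin n → ℝ) => z.1 i * z.2 i - t) z d
      = z.1 i * d.2 i + z.2 i * d.1 i := fun i d => by
    rw [(((hfst i).fun_mul (hsnd i)).sub_const t).fderiv]
    simp
  have hd6 : ∀ i d, fderiv ℝ (fun z : (Fin n → ℝ) × (Fin n → ℝ) => -t - z.1 i * z.2 i) z d
      = -(z.1 i * d.2 i + z.2 i * d.1 i) := fun i d => by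
    rw [(((hfst i).fun_mul (hsnd i)).const_sub (-t)).fderiv]
    simp
  simp only [hFd, Fintype.sum_sum_type, hG, Sum.elim_inl, Sum.elim_inr, hd2, hd3, hd4, hd5, hd6,
    fderiv_comp_fst_apply (hg _), fderiv_comp_fst_apply (hh _), Finset.univ_unique,
    Finset.sum_singleton] at hWs
  simp only [hG, Sum.forall, Sum.elim_inl, Sum.elim_inr] at hWc hWlam
  obtain ⟨hc1, hc2, hc3, hc4, hc5, hc6⟩ := hWc
  obtain ⟨hl1, hl2, hl3, hl4, hl5, hl6⟩ := hWlam
  set nu0 : Fin n → ℝ := fun i => W.2.1 (.inr (.inl i)) with hnu0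
  set nu1 : Fin n → ℝ := fun i => W.2.1 (.inr (.inr (.inl i))) with hnu1
  set rho : ℝ := W.2.1 (.inr (.inr (.inr (.inl ())))) with hrho
  set dpl : Fin n → ℝ := fun i => W.2.1 (.inr (.inr (.inr (.inr (.inl i))))) with hdpl
  set dmi : Fin n → ℝ := fun i => W.2.1 (.inr (.inr (.inr (.inr (.inr i))))) with hdmi
  have hsy : ∀ i, -nu0 i + nu1 i - rho + (dpl i - dmi i) * z.1 i = 0 := fun i => by
    have := hWs (0, Pi.single i 1)
    simp [D1, Pi.single_apply] at this
    simp only [hnu0, hnu1, hrho, hdpl, hdmi]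
    linarith
  have e0 : ∀ i, nu0 i * z.2 i = 0 := fun i => by linarith [hc2 i]
  have e1 : ∀ i, nu1 i * (z.2 i - 1) = 0 := hc3
  have e5 : ∀ i, dpl i * (z.1 i * z.2 i - t) = 0 := hc5
  have e6 : ∀ i, dmi i * (z.1 i * z.2 i + t) = 0 := fun i => by linarith [hc6 i]
  refine ⟨(W.1, fun i => W.2.1 (.inl i), W.2.2, fun i => (dpl i - dmi i) * z.2 i), fun h0 => hW0 ?_,
    fun d => ?_, hWobj, hl1, hc1, nu0, nu1, rho, dpl, dmi, fun _ => rfl, hsy, hl2, hl3, hl4 (),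
    hl5, hl6, e0, e1, by linarith [hc4 ()], e5, e6⟩
  · simp only [Prod.mk_eq_zero] at h0
    obtain ⟨k1, k2, k3, k4⟩ := h0
    obtain ⟨a1, a2, a3, a4, a5⟩ := isRegFJMult_aux_eq_zero ht hsy hl2 (hl4 ()) e0 e1 e5 e6
      (fun i => congrFun k4 i) hy
    refine Prod.ext k1 (Prod.ext (funext ?_) k3)
    simp only [Sum.forall]
    exact ⟨fun i => congrFun k2 i, fun i => congrFun a1 i, fun i => congrFun a2 i, fun _ => a3,
      fun i => congrFun a4 i, fun i => congrFun a5 i⟩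
  · have := hWs (d, 0)
    simp only [Pi.zero_apply, neg_zero, mul_zero, Finset.sum_const_zero, zero_add] at this
    rw [← this, lagDeriv]
    have hsplit : ∑ i, (dpl i - dmi i) * z.2 i * d i
        = ∑ i, dpl i * (z.2 i * d i) + ∑ i, dmi i * -(z.2 i * d i) := by
      rw [← Finset.sum_add_distrib]
      exact Finset.sum_congr rfl fun i _ => by ring
    simp only [hsplit]
    simp only [hdpl, hdmi]
    ring

lemma KKTReg.exists_isRegFJMult {t : ℝ} {z : (Fin n → ℝ) × (Fin n → ℝ)}
    (hz : KKTReg f g h κ t z) : ∃ w, w ≠ 0 ∧ IsRegFJMult f g h κ t z w := by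
  obtain ⟨-, lam, mu, nu0, nu1, rho, dpl, dmi, h1, h2, h3, h4, h5, h6, h7, h8, h9, h10, h11, h12,
    h13, h14⟩ := hz
  exact ⟨(1, lam, mu, fun i => (dpl i - dmi i) * z.2 i),
    fun h0 => one_ne_zero (congrArg Prod.fst h0),
    fun d => by simpa [lagDeriv] using h1 d, zero_le_one, h3, h9, nu0, nu1, rho, dpl, dmi,
    fun _ => rfl, h2, h4, h5, h6, h7, h8, h10, h11, h12, h13, h14⟩

lemma IsRegFJMult.kktReg {t : ℝ} {z : (Fin n → ℝ) × (Fin n → ℝ)}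
    {w : ℝ × (Fin m → ℝ) × (Fin p → ℝ) × (Fin n → ℝ)} (hw : IsRegFJMult f g h κ t z w)
    (hz : z ∈ ZReg g h κ t) (hpos : 0 < w.1) : KKTReg f g h κ t z := by
  obtain ⟨hs, -, hl, hlc, nu0, nu1, rho, dpl, dmi, hgam, h2, h4, h5, h6, h7, h8, h10, h11, h12,
    h13, h14⟩ := hw
  have hi := (inv_pos.2 hpos).le
  set s := w.1⁻¹ with hs'
  have hs1 : s * w.1 = 1 := inv_mul_cancel₀ hpos.ne'
  refine ⟨hz, fun i => s * w.2.1 i, fun i => s * w.2.2.1 i, fun i => s * nu0 i, fun i => s * nu1 i,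
    s * rho, fun i => s * dpl i, fun i => s * dmi i, fun d => ?_, fun i => ?_,
    fun i => mul_nonneg hi (hl i), fun i => mul_nonneg hi (h4 i), fun i => mul_nonneg hi (h5 i),
    mul_nonneg hi h6, fun i => mul_nonneg hi (h7 i), fun i => mul_nonneg hi (h8 i),
    fun i => ?_, fun i => ?_, fun i => ?_, ?_, fun i => ?_, fun i => ?_⟩
  · have h1 : lagDeriv f g h z.1 (s • w) d = 0 := by rw [lagDeriv_smul, hs, mul_zero]
    simp only [lagDeriv, Prod.smul_fst, Prod.smul_snd, Pi.smul_apply, smul_eq_mul, hs1, one_mul,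
      hgam] at h1
    rw [← h1]
    congr 1
    exact Finset.sum_congr rfl fun i _ => by ring
  · linear_combination s * h2 i
  · linear_combination s * hlc i
  · linear_combination s * h10 i
  · linear_combination s * h11 i
  · linear_combination s * h12
  · linear_combination s * h13 i
  · linear_combination s * h14 i

end

section
variable {n m p : ℕ} {f : (Fin n → ℝ) → ℝ} {g : (Fin n → ℝ) → Fin m → ℝ}
  {h : (Fin n → ℝ) → Fin p → ℝ} {κ : ℕ} {xs : Fin n → ℝ}

lemma tendsto_sub_div {φ : (Fin n → ℝ) → ℝ} (hφ : DifferentiableAt ℝ φ xs)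
    {v : ℕ → Fin n → ℝ} (hv0 : Tendsto v atTop (𝓝 0))
    {d : Fin n → ℝ} (hd : Tendsto (fun k => ‖v k‖⁻¹ • v k) atTop (𝓝 d)) :
    Tendsto (fun k => ‖v k‖⁻¹ * (φ (xs + v k) - φ xs)) atTop (𝓝 (D1 φ xs d)) := by
  exact hφ.hasFDerivAt.hasFDerivWithinAt.lim (s := univ) hv0 (by simp) hd

lemma tendsto_D1_sub_div {φ : (Fin n → ℝ) → ℝ} (hφ : ContDiff ℝ 2 φ)
    {v : ℕ → Fin n → ℝ} (hv0 : Tendsto v atTop (𝓝 0))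
    {d : Fin n → ℝ} (hd : Tendsto (fun k => ‖v k‖⁻¹ • v k) atTop (𝓝 d)) :
    Tendsto (fun k => ‖v k‖⁻¹ * (D1 φ (xs + v k) (‖v k‖⁻¹ • v k) - D1 φ xs (‖v k‖⁻¹ • v k)))
      atTop (𝓝 (D2 φ xs d)) := by
  have hdiff : DifferentiableAt ℝ (fderiv ℝ φ) xs :=
    (hφ.fderiv_right (m := 1) (by norm_num)).differentiable one_ne_zero xs
  have h1 := hdiff.hasFDerivAt.hasFDerivWithinAt.lim (s := univ) hv0 (by simp) hd
  rw [D2, iteratedFDeriv_two_apply]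
  exact (isBoundedBilinearMap_apply.continuous.tendsto _).comp (h1.prodMk_nhds hd)

/-- First-order Taylor bound with quadratic remainder for a `C²` function. -/
lemma exists_eventually_abs_sub_D1_le {φ : (Fin n → ℝ) → ℝ} (hφ : ContDiff ℝ 2 φ)
    (xs : Fin n → ℝ) :
    ∃ K, ∀ᶠ x in 𝓝 xs, |φ x - φ xs - D1 φ xs (x - xs)| ≤ K * ‖x - xs‖ ^ 2 := by
  have hdiff : DifferentiableAt ℝ (fderiv ℝ φ) xs :=
    (hφ.fderiv_right (m := 1) (by norm_num)).differentiable one_ne_zero xs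
  obtain ⟨K, hK⟩ := hdiff.hasFDerivAt.isBigO_sub.bound
  obtain ⟨r, hr, hball⟩ := Metric.eventually_nhds_iff_ball.1 hK
  refine ⟨K, ?_⟩
  filter_upwards [Metric.ball_mem_nhds xs hr] with x hx
  have hK0 : 0 ≤ K * ‖x - xs‖ := (norm_nonneg _).trans (hball x hx)
  have hbd : ∀ y ∈ segment ℝ xs x, ‖fderiv ℝ φ y - fderiv ℝ φ xs‖ ≤ K * ‖x - xs‖ := by
    intro y hy
    have hyx : ‖y - xs‖ ≤ ‖x - xs‖ := norm_sub_le_of_mem_segment hy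
    have hyb : y ∈ Metric.ball xs r := by
      rw [mem_ball_iff_norm] at hx ⊢
      exact hyx.trans_lt hx
    rcases eq_or_ne x xs with rfl | hne
    · have : y = x := by simpa [sub_eq_zero] using hyx
      simp [this]
    · have hK1 : 0 ≤ K := nonneg_of_mul_nonneg_left hK0 (norm_pos_iff.2 (sub_ne_zero.2 hne))
      exact (hball y hyb).trans (mul_le_mul_of_nonneg_left hyx hK1)
  have := (convex_segment xs x).norm_image_sub_le_of_norm_fderiv_le' (f := φ) (𝕜 := ℝ)
    (φ := fderiv ℝ φ xs)
    (fun y _ => hφ.differentiable two_ne_zero y) hbd (left_mem_segment ℝ xs x)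
    (right_mem_segment ℝ xs x)
  rw [Real.norm_eq_abs] at this
  calc _ ≤ _ := this
    _ = _ := by ring

lemma tendsto_mul_D1_div_zero {φ : (Fin n → ℝ) → ℝ} (hφ : ContDiff ℝ 2 φ)
    {v : ℕ → Fin n → ℝ} (hv : ∀ k, v k ≠ 0) (hv0 : Tendsto v atTop (𝓝 0))
    {a : ℕ → ℝ} (ha : Tendsto a atTop (𝓝 0))
    (hav : ∀ᶠ k in atTop, φ (xs + v k) = φ xs ∨ a k = 0) :
    Tendsto (fun k => ‖v k‖⁻¹ * (a k * D1 φ xs (‖v k‖⁻¹ • v k))) atTop (𝓝 0) := by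
  obtain ⟨K, hK⟩ := exists_eventually_abs_sub_D1_le hφ xs
  have hx : Tendsto (fun k => xs + v k) atTop (𝓝 xs) := by
    simpa using hv0.const_add xs
  refine squeeze_zero_norm' (a := fun k => |a k| * |K|) ?_ (by simpa using ha.abs.mul_const |K|)
  filter_upwards [hav, hx.eventually hK] with k h1 h2
  have hpos : 0 < ‖v k‖ := norm_pos_iff.2 (hv k)
  rcases h1 with h1 | h1
  · rw [h1, sub_self, zero_sub, abs_neg, add_sub_cancel_left] at h2
    have h3 : D1 φ xs (‖v k‖⁻¹ • v k) = ‖v k‖⁻¹ * D1 φ xs (v k) := by simp [D1]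
    rw [h3, norm_mul, norm_mul, norm_mul, norm_inv, norm_norm, Real.norm_eq_abs, Real.norm_eq_abs]
    have h4 : |D1 φ xs (v k)| ≤ |K| * ‖v k‖ ^ 2 :=
      h2.trans (mul_le_mul_of_nonneg_right (le_abs_self K) (sq_nonneg _))
    calc ‖v k‖⁻¹ * (|a k| * (‖v k‖⁻¹ * |D1 φ xs (v k)|))
        ≤ ‖v k‖⁻¹ * (|a k| * (‖v k‖⁻¹ * (|K| * ‖v k‖ ^ 2))) := by gcongr
      _ = |a k| * |K| := by field_simp
  · simp [h1]

lemma lagDeriv_sub_lagDeriv (x y : Fin n → ℝ)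
    (w v : ℝ × (Fin m → ℝ) × (Fin p → ℝ) × (Fin n → ℝ)) (u : Fin n → ℝ) (s : ℝ) :
    s * (lagDeriv f g h x w u - lagDeriv f g h y v u) =
      (w.1 * (s * (D1 f x u - D1 f y u))
        + ∑ i, w.2.1 i * (s * (D1 (fun x' => g x' i) x u - D1 (fun x' => g x' i) y u))
        + ∑ i, w.2.2.1 i * (s * (D1 (fun x' => h x' i) x u - D1 (fun x' => h x' i) y u)))
      + (s * ((w.1 - v.1) * D1 f y u)
        + ∑ i, s * ((w.2.1 i - v.2.1 i) * D1 (fun x' => g x' i) y u)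
        + ∑ i, s * ((w.2.2.1 i - v.2.2.1 i) * D1 (fun x' => h x' i) y u)
        + ∑ i, s * ((w.2.2.2 i - v.2.2.2 i) * u i)) := by
  simp only [lagDeriv, mul_sub, sub_mul, mul_add, Finset.mul_sum, Finset.sum_sub_distrib,
    mul_left_comm s]
  ring

/-- Under CC-MFCQ and the second-order condition, `xs` is an isolated tightened Fritz John
point. -/
lemma exists_isolated_isTightFJMult (hf : ContDiff ℝ 2 f)
    (hg : ∀ i, ContDiff ℝ 2 (fun x => g x i)) (hh : ∀ i, ContDiff ℝ 2 (fun x => h x i))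
    (hgs : ∀ i, g xs i ≤ 0) (hhs : ∀ i, h xs i = 0) (hmfcq : CCMFCQ g h xs)
    (hsoc : ∀ w, IsTightFJMult f g h xs xs w → 0 < w.1 → ∀ d, d ≠ 0 →
      (∀ i, g xs i = 0 → D1 (fun x' => g x' i) xs d ≤ 0) →
      (∀ i, D1 (fun x' => h x' i) xs d = 0) → (∀ i, xs i = 0 → d i = 0) → D1 f xs d ≤ 0 →
      0 < w.1 * D2 f xs d + ∑ i, w.2.1 i * D2 (fun x' => g x' i) xs d
        + ∑ i, w.2.2.1 i * D2 (fun x' => h x' i) xs d) :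
    ∃ r > 0, ∀ x, dist x xs < r → (∀ i, g x i ≤ 0) → (∀ i, h x i = 0) →
      (∀ i, xs i = 0 → x i = 0) → ∀ w, w ≠ 0 → IsTightFJMult f g h xs x w → x = xs := by
  by_contra! hcon
  choose X hXd hXg hXh hXz W hW0 hWm hXne using
    fun k : ℕ => hcon (1 / ((k : ℝ) + 1)) (by positivity)
  have hXlim : Tendsto X atTop (𝓝 xs) := by
    rw [tendsto_iff_dist_tendsto_zero]
    exact squeeze_zero (fun _ => dist_nonneg) (fun k => (hXd k).le)
      tendsto_one_div_add_atTop_nhds_zero_nat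
  obtain ⟨d, hd1, φ, hφ, hdlim⟩ := exists_subseq_tendsto_normalize (fun k => X k - xs)
    fun k => sub_ne_zero.2 (hXne k)
  obtain ⟨w₀, hw1, ψ, hψ, hwlim⟩ := exists_subseq_tendsto_normalize (fun k => W (φ k))
    fun k => hW0 _
  set v : ℕ → Fin n → ℝ := fun k => X (φ (ψ k)) - xs with hvdef
  set w : ℕ → ℝ × (Fin m → ℝ) × (Fin p → ℝ) × (Fin n → ℝ) :=
    fun k => ‖W (φ (ψ k))‖⁻¹ • W (φ (ψ k)) with hwdef
  have hxv : ∀ k, X (φ (ψ k)) = xs + v k := fun k => by simp [hvdef]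
  have hv : ∀ k, v k ≠ 0 := fun k => sub_ne_zero.2 (hXne _)
  have hxlim : Tendsto (fun k => xs + v k) atTop (𝓝 xs) := by
    simpa only [← hxv, Function.comp_def] using (hXlim.comp hφ.tendsto_atTop).comp hψ.tendsto_atTop
  have hv0 : Tendsto v atTop (𝓝 0) := by simpa using hxlim.sub_const xs
  have hd : Tendsto (fun k => ‖v k‖⁻¹ • v k) atTop (𝓝 d) := hdlim.comp hψ.tendsto_atTop
  have hwm : ∀ k, IsTightFJMult f g h xs (xs + v k) (w k) := fun k => by
    rw [← hxv]
    exact (hWm _).smul (by positivity)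
  have hwobj : Tendsto (fun k => (w k).1) atTop (𝓝 w₀.1) := (continuous_fst.tendsto w₀).comp hwlim
  have hwlam : ∀ i, Tendsto (fun k => (w k).2.1 i) atTop (𝓝 (w₀.2.1 i)) :=
    fun i => ((by fun_prop : Continuous
      fun w : ℝ × (Fin m → ℝ) × (Fin p → ℝ) × (Fin n → ℝ) => w.2.1 i).tendsto w₀).comp hwlim
  have hwmu : ∀ i, Tendsto (fun k => (w k).2.2.1 i) atTop (𝓝 (w₀.2.2.1 i)) :=
    fun i => ((by fun_prop : Continuous
      fun w : ℝ × (Fin m → ℝ) × (Fin p → ℝ) × (Fin n → ℝ) => w.2.2.1 i).tendsto w₀).comp hwlim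
  have hwgam : ∀ i, Tendsto (fun k => (w k).2.2.2 i) atTop (𝓝 (w₀.2.2.2 i)) :=
    fun i => ((by fun_prop : Continuous
      fun w : ℝ × (Fin m → ℝ) × (Fin p → ℝ) × (Fin n → ℝ) => w.2.2.2 i).tendsto w₀).comp hwlim
  have hf1 : ContDiff ℝ 1 f := hf.of_le one_le_two
  have hg1 := fun i => (hg i).of_le one_le_two
  have hh1 := fun i => (hh i).of_le one_le_two
  have hglim : ∀ i, Tendsto (fun k => g (xs + v k) i) atTop (𝓝 (g xs i)) := fun i =>
    ((hg i).continuous.tendsto xs).comp hxlim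
  have hm₀ : IsTightFJMult f g h xs xs w₀ := by
    refine ⟨fun e => ?_, ?_, fun i => ?_, fun i => ?_, fun i hi => ?_⟩
    · exact tendsto_nhds_unique (((continuous_lagDeriv hf1 hg1 hh1 e).tendsto (xs, w₀)).comp
        (hxlim.prodMk_nhds hwlim)) (tendsto_const_nhds.congr fun k => ((hwm k).stat e).symm)
    · exact ge_of_tendsto hwobj (Eventually.of_forall fun k => (hwm k).obj_nonneg)
    · exact ge_of_tendsto (hwlam i) (Eventually.of_forall fun k => (hwm k).lam_nonneg i)
    · exact tendsto_nhds_unique ((hwlam i).mul (hglim i))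
        (tendsto_const_nhds.congr fun k => ((hwm k).compl i).symm)
    · exact tendsto_nhds_unique (hwgam i)
        (tendsto_const_nhds.congr fun k => ((hwm k).gam_eq_zero i hi).symm)
  have hpos : 0 < w₀.1 := hm₀.obj_pos hmfcq fun h0 => by simp [h0] at hw1
  have hgd : ∀ i, g xs i = 0 → D1 (fun x' => g x' i) xs d ≤ 0 := fun i hi => by
    refine le_of_tendsto (tendsto_sub_div ((hg i).differentiable two_ne_zero xs) hv0 hd)
      (Eventually.of_forall fun k => mul_nonpos_of_nonneg_of_nonpos (by positivity) ?_)
    have := hXg (φ (ψ k)) i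
    rw [hxv] at this
    linarith
  have hhd : ∀ i, D1 (fun x' => h x' i) xs d = 0 := fun i => by
    refine tendsto_nhds_unique
      (tendsto_sub_div ((hh i).differentiable two_ne_zero xs) hv0 hd)
      (tendsto_const_nhds.congr fun k => ?_)
    have := hXh (φ (ψ k)) i
    rw [hxv] at this
    rw [this, hhs, sub_zero, mul_zero]
  have hvz : ∀ k i, xs i = 0 → v k i = 0 := fun k i hi => by simp [hvdef, hXz _ i hi, hi]
  have hdz : ∀ i, xs i = 0 → d i = 0 := fun i hi => by
    refine tendsto_nhds_unique ((tendsto_pi_nhds.1 hd) i) (tendsto_const_nhds.congr fun k => ?_)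
    simp [hvz k i hi]
  have hgact : ∀ i, 0 < w₀.2.1 i → ∀ᶠ k in atTop, g (xs + v k) i = 0 := fun i hi => by
    filter_upwards [(hwlam i).eventually_const_lt hi] with k hk
    exact (mul_eq_zero.1 ((hwm k).compl i)).resolve_left hk.ne'
  have hfd : D1 f xs d ≤ 0 := by
    have h1 := hm₀.stat d
    have h2 : ∑ i, w₀.2.1 i * D1 (fun x' => g x' i) xs d = 0 := by
      refine Finset.sum_eq_zero fun i _ => ?_
      rcases (hm₀.lam_nonneg i).eq_or_lt with hi | hi
      · rw [← hi, zero_mul]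
      · have hgi : g xs i = 0 := (mul_eq_zero.1 (hm₀.compl i)).resolve_left hi.ne'
        rw [tendsto_nhds_unique
          (tendsto_sub_div ((hg i).differentiable two_ne_zero xs) hv0 hd)
          (tendsto_const_nhds.congr' (f₁ := fun _ => (0 : ℝ)) ?_), mul_zero]
        filter_upwards [hgact i hi] with k hk
        rw [hk, hgi, sub_zero, mul_zero]
    have h3 : ∑ i, w₀.2.2.2 i * d i = 0 := Finset.sum_eq_zero fun i _ => by
      by_cases hi : xs i = 0
      · rw [hdz i hi, mul_zero]
      · rw [hm₀.gam_eq_zero i hi, zero_mul]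
    simp only [lagDeriv, h2, h3, hhd, mul_zero, Finset.sum_const_zero, add_zero] at h1
    exact ((mul_eq_zero.1 h1).resolve_left hpos.ne').le
  refine (hsoc w₀ hm₀ hpos d (fun h0 => by simp [h0] at hd1) hgd hhd hdz hfd).ne' ?_
  set b : ℕ → ℝ := fun k => (w k).1 / w₀.1 with hb
  have hblim : Tendsto b atTop (𝓝 1) := by
    simpa [div_self hpos.ne'] using hwobj.div_const w₀.1
  have hdiff : ∀ {a : ℕ → ℝ} {a₀ : ℝ}, Tendsto a atTop (𝓝 a₀) →
      Tendsto (fun k => a k - b k * a₀) atTop (𝓝 0) := fun {a a₀} ha => by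
    simpa using ha.sub (hblim.mul_const a₀)
  have hA : Tendsto (fun k => (w k).1 * (‖v k‖⁻¹ * (D1 f (xs + v k) (‖v k‖⁻¹ • v k)
          - D1 f xs (‖v k‖⁻¹ • v k)))
        + ∑ i, (w k).2.1 i * (‖v k‖⁻¹ * (D1 (fun x' => g x' i) (xs + v k) (‖v k‖⁻¹ • v k)
          - D1 (fun x' => g x' i) xs (‖v k‖⁻¹ • v k)))
        + ∑ i, (w k).2.2.1 i * (‖v k‖⁻¹ * (D1 (fun x' => h x' i) (xs + v k) (‖v k‖⁻¹ • v k)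
          - D1 (fun x' => h x' i) xs (‖v k‖⁻¹ • v k)))) atTop
      (𝓝 (w₀.1 * D2 f xs d + ∑ i, w₀.2.1 i * D2 (fun x' => g x' i) xs d
        + ∑ i, w₀.2.2.1 i * D2 (fun x' => h x' i) xs d)) :=
    ((hwobj.mul (tendsto_D1_sub_div hf hv0 hd)).add
      (tendsto_finsetSum _ fun i _ => (hwlam i).mul (tendsto_D1_sub_div (hg i) hv0 hd))).add
      (tendsto_finsetSum _ fun i _ => (hwmu i).mul (tendsto_D1_sub_div (hh i) hv0 hd))
  have hBg : Tendsto (fun k => ∑ i, ‖v k‖⁻¹ * (((w k).2.1 i - b k * w₀.2.1 i) *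
      D1 (fun x' => g x' i) xs (‖v k‖⁻¹ • v k))) atTop (𝓝 (∑ _i : Fin m, 0)) := by
    refine tendsto_finsetSum _ fun i _ =>
      tendsto_mul_D1_div_zero (hg i) hv hv0 (hdiff (hwlam i)) ?_
    rcases (hm₀.lam_nonneg i).eq_or_lt with hi | hi
    · rcases (hgs i).eq_or_lt with hgi | hgi
      · refine Eventually.of_forall fun k => ?_
        rw [← hi, mul_zero, sub_zero, hgi]
        exact (mul_eq_zero.1 ((hwm k).compl i)).symm
      · filter_upwards [(hglim i).eventually_lt_const hgi] with k hk
        right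
        rw [← hi, mul_zero, sub_zero]
        exact (mul_eq_zero.1 ((hwm k).compl i)).resolve_right hk.ne
    · have hgi : g xs i = 0 := (mul_eq_zero.1 (hm₀.compl i)).resolve_left hi.ne'
      filter_upwards [hgact i hi] with k hk
      exact Or.inl (hk.trans hgi.symm)
  have hBh : Tendsto (fun k => ∑ i, ‖v k‖⁻¹ * (((w k).2.2.1 i - b k * w₀.2.2.1 i) *
      D1 (fun x' => h x' i) xs (‖v k‖⁻¹ • v k))) atTop (𝓝 (∑ _i : Fin p, 0)) := by
    refine tendsto_finsetSum _ fun i _ =>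
      tendsto_mul_D1_div_zero (hh i) hv hv0 (hdiff (hwmu i)) (Eventually.of_forall fun k => ?_)
    have := hXh (φ (ψ k)) i
    rw [hxv] at this
    exact Or.inl (this.trans (hhs i).symm)
  have hlim := hA.add (hBg.add hBh)
  simp only [Finset.sum_const_zero, add_zero] at hlim
  refine tendsto_nhds_unique hlim (tendsto_const_nhds.congr fun k => ?_)
  have key := lagDeriv_sub_lagDeriv (f := f) (g := g) (h := h) (xs + v k) xs (w k) (b k • w₀)
    (‖v k‖⁻¹ • v k) ‖v k‖⁻¹
  rw [(hwm k).stat, lagDeriv_smul, hm₀.stat, mul_zero, sub_zero, mul_zero] at key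
  rw [key]
  have hb1 : (w k).1 - b k * w₀.1 = 0 := by
    rw [hb, div_mul_cancel₀ _ hpos.ne', sub_self]
  have hgz : ∀ i, ‖v k‖⁻¹ * (((w k).2.2.2 i - b k * w₀.2.2.2 i) * (‖v k‖⁻¹ * v k i)) = 0 :=
    fun i => by
      by_cases hi : xs i = 0
      · simp [hvz k i hi]
      · simp [(hwm k).gam_eq_zero i hi, hm₀.gam_eq_zero i hi]
  simp only [Prod.smul_fst, Prod.smul_snd, Pi.smul_apply, smul_eq_mul, hb1, hgz, zero_mul,
    mul_zero, Finset.sum_const_zero, zero_add, add_zero]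

end

section
variable {n m p : ℕ} {f : (Fin n → ℝ) → ℝ} {g : (Fin n → ℝ) → Fin m → ℝ}
  {h : (Fin n → ℝ) → Fin p → ℝ} {κ : ℕ} {xs : Fin n → ℝ}

lemma ZSet_subset_ZReg {t : ℝ} (ht : 0 ≤ t) : ZSet g h κ ⊆ ZReg g h κ t :=
  fun _ ⟨h1, h2, h3, h4, h5, h6⟩ =>
    ⟨h1, h2, h3, h4, h5, fun i => by rw [h6 i]; exact ht, fun i => by rw [h6 i]; linarith⟩

/-- If `‖xs‖₀ = κ`, then `y` is determined by feasibility of `(xs, y)`. -/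
lemma eq_indicator_of_mem_ZSet (hcard : card0 xs = κ) {ys : Fin n → ℝ}
    (hz : (xs, ys) ∈ ZSet g h κ) : ys = fun i => if xs i = 0 then 1 else 0 := by
  obtain ⟨c, hc, hcx⟩ := exists_pos_le_abs xs
  funext i
  have h1 := abs_sub_indicator_le hc le_rfl hcard (ZSet_subset_ZReg le_rfl hz)
    (hcx xs (by simpa using hc.le)) i
  rw [zero_div, mul_zero] at h1
  exact sub_eq_zero.1 (abs_nonpos_iff.1 h1)

/-- Feasibility of `(x, y)` for the indicator `y` of the zero set of `xs`. -/
lemma mk_indicator_mem_ZSet (hcard : card0 xs = κ) {x : Fin n → ℝ} (hg : ∀ i, g x i ≤ 0)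
    (hh : ∀ i, h x i = 0) (hx : ∀ i, xs i = 0 → x i = 0) :
    (x, fun i => if xs i = 0 then (1 : ℝ) else 0) ∈ ZSet g h κ := by
  refine ⟨hg, hh, fun i => ?_, fun i => ?_, ?_, fun i => ?_⟩
  · dsimp only
    split_ifs <;> norm_num
  · dsimp only
    split_ifs <;> norm_num
  · simp only [card0_eq_sum, hcard, le_refl]
  · by_cases hi : xs i = 0 <;> simp [hi, hx]

/-- Fritz John points of the regularized programs near an isolated tightened Fritz John point
converge to it. -/
lemma tendsto_of_isRegFJMult (hf : ContDiff ℝ 1 f)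
    (hg : ∀ i, ContDiff ℝ 1 (fun x => g x i)) (hh : ∀ i, ContDiff ℝ 1 (fun x => h x i))
    {c r : ℝ} (hc : 0 < c) (hcx : ∀ x, dist x xs ≤ r → ∀ i, xs i ≠ 0 → c ≤ |x i|)
    (hcard : card0 xs = κ)
    (hiso : ∀ x, dist x xs ≤ r → (∀ i, g x i ≤ 0) → (∀ i, h x i = 0) →
      (∀ i, xs i = 0 → x i = 0) → ∀ w, w ≠ 0 → IsTightFJMult f g h xs x w → x = xs)
    {t : ℕ → ℝ} (ht : ∀ k, 0 < t k) (htl : Tendsto t atTop (𝓝 0))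
    {z : ℕ → (Fin n → ℝ) × (Fin n → ℝ)} (hz : ∀ k, z k ∈ ZReg g h κ (t k))
    (hzr : ∀ k, dist (z k).1 xs ≤ r)
    (hw : ∀ k, ∃ w, w ≠ 0 ∧ IsRegFJMult f g h κ (t k) (z k) w) :
    Tendsto z atTop (𝓝 (xs, fun i => if xs i = 0 then 1 else 0)) := by
  choose w hw0 hwm using hw
  refine tendsto_of_subseq_tendsto fun ns hns => ?_
  obtain ⟨xb, hxb, φ, hφ, hlim⟩ := (isCompact_closedBall xs r).tendsto_subseq
    (x := fun k => (z (ns k)).1) fun k => hzr (ns k)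
  have htl' := htl.comp (hns.comp hφ.tendsto_atTop)
  obtain ⟨h1, h2, h3, h4⟩ := feasible_of_tendsto (t := fun k => t (ns (φ k)))
    (z := fun k => z (ns (φ k))) (fun i => (hg i).continuous) (fun i => (hh i).continuous) hc hcard
    (fun _ => ht _) htl' (fun _ => hz _) (fun _ => hcx _ (hzr _)) hlim
  obtain ⟨w₀, hw₀, hm₀, -⟩ := exists_isTightFJMult_of_tendsto (t := fun k => t (ns (φ k)))
    (z := fun k => z (ns (φ k))) hf hg hh hc hcard
    (fun _ => ht _) htl' (fun _ => hz _) (fun _ => hcx _ (hzr _)) hlim (fun _ => hwm _)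
    fun _ => hw0 _
  obtain rfl := hiso xb hxb h1 h2 h3 w₀ hw₀ hm₀
  exact ⟨φ, hlim.prodMk_nhds h4⟩

/-- Localized minimizers of the regularized programs converge to a strict local minimum. -/
lemma tendsto_of_isMin (hf : Continuous f)
    (hg : ∀ i, Continuous (fun x => g x i)) (hh : ∀ i, Continuous (fun x => h x i))
    {c r : ℝ} (hc : 0 < c) (hr : 0 ≤ r) (hcx : ∀ x, dist x xs ≤ r → ∀ i, xs i ≠ 0 → c ≤ |x i|)
    (hcard : card0 xs = κ) (hgs : ∀ i, g xs i ≤ 0) (hhs : ∀ i, h xs i = 0)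
    (hstrict : ∀ x, dist x xs ≤ r → (∀ i, g x i ≤ 0) → (∀ i, h x i = 0) →
      (∀ i, xs i = 0 → x i = 0) → x ≠ xs → f xs < f x)
    {t : ℕ → ℝ} (ht : ∀ k, 0 < t k) (htl : Tendsto t atTop (𝓝 0))
    {z : ℕ → (Fin n → ℝ) × (Fin n → ℝ)} (hz : ∀ k, z k ∈ ZReg g h κ (t k))
    (hzr : ∀ k, dist (z k).1 xs ≤ r)
    (hzmin : ∀ k, ∀ z' ∈ ZReg g h κ (t k), dist z'.1 xs ≤ r → f (z k).1 ≤ f z'.1) :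
    Tendsto z atTop (𝓝 (xs, fun i => if xs i = 0 then 1 else 0)) := by
  refine tendsto_of_subseq_tendsto fun ns hns => ?_
  obtain ⟨xb, hxb, φ, hφ, hlim⟩ := (isCompact_closedBall xs r).tendsto_subseq
    (x := fun k => (z (ns k)).1) fun k => hzr (ns k)
  obtain ⟨h1, h2, h3, h4⟩ := feasible_of_tendsto (t := fun k => t (ns (φ k)))
    (z := fun k => z (ns (φ k))) hg hh hc hcard
    (fun _ => ht _) (htl.comp (hns.comp hφ.tendsto_atTop)) (fun _ => hz _)
    (fun _ => hcx _ (hzr _)) hlim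
  have hle : f xb ≤ f xs := le_of_tendsto ((hf.tendsto xb).comp hlim) <|
    Eventually.of_forall fun k => hzmin _ _
      (ZSet_subset_ZReg (ht _).le (mk_indicator_mem_ZSet hcard hgs hhs fun _ hi => hi))
      (by simpa using hr)
  obtain rfl : xb = xs := by
    by_contra hne
    exact (hstrict xb hxb h1 h2 h3 hne).not_ge hle
  exact ⟨φ, hlim.prodMk_nhds h4⟩

lemma exists_isMin_ZReg (hf : Continuous f) (hg : ∀ i, Continuous (fun x => g x i))
    (hh : ∀ i, Continuous (fun x => h x i)) {t r : ℝ}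
    (hne : ∃ z ∈ ZReg g h κ t, dist z.1 xs ≤ r) :
    ∃ z ∈ ZReg g h κ t, dist z.1 xs ≤ r ∧
      ∀ z' ∈ ZReg g h κ t, dist z'.1 xs ≤ r → f z.1 ≤ f z'.1 := by
  have hg' := fun i => (hg i).comp (continuous_fst (X := Fin n → ℝ) (Y := Fin n → ℝ))
  have hh' := fun i => (hh i).comp (continuous_fst (X := Fin n → ℝ) (Y := Fin n → ℝ))
  have hcl : IsClosed (ZReg g h κ t) := by
    simp only [ZReg, ofPred_and, ofPred_forall]
    refine .inter (isClosed_iInter fun i => isClosed_le (hg' i) continuous_const) <|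
      .inter (isClosed_iInter fun i => isClosed_eq (hh' i) continuous_const) <|
      .inter (isClosed_iInter fun i => isClosed_le ?_ ?_) <|
      .inter (isClosed_iInter fun i => isClosed_le ?_ ?_) <|
      .inter (isClosed_le ?_ ?_) <|
      .inter (isClosed_iInter fun i => isClosed_le ?_ ?_)
        (isClosed_iInter fun i => isClosed_le ?_ ?_) <;> fun_prop
  have hcpt : IsCompact (ZReg g h κ t ∩ {z | dist z.1 xs ≤ r}) :=
    ((isCompact_closedBall xs r).prod
      (isCompact_Icc (a := (0 : Fin n → ℝ)) (b := 1))).of_isClosed_subset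
      (hcl.inter (isClosed_le (by fun_prop) continuous_const))
      fun z hz => ⟨hz.2, fun i => hz.1.2.2.1 i, fun i => hz.1.2.2.2.1 i⟩
  obtain ⟨z, hz, hmin⟩ := hcpt.exists_isMinOn hne (hf.comp continuous_fst).continuousOn
  exact ⟨z, hz.1, hz.2, fun z' h1 h2 => hmin ⟨h1, h2⟩⟩

/-- Near a strict local minimum satisfying CC-MFCQ the regularized programs eventually have KKT
points. -/
lemma eventually_exists_kktReg (hf : ContDiff ℝ 1 f)
    (hg : ∀ i, ContDiff ℝ 1 (fun x => g x i)) (hh : ∀ i, ContDiff ℝ 1 (fun x => h x i))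
    {c r : ℝ} (hc : 0 < c) (hr : 0 < r) (hcx : ∀ x, dist x xs ≤ r → ∀ i, xs i ≠ 0 → c ≤ |x i|)
    (hκ0 : 0 < κ) (hcard : card0 xs = κ) (hmfcq : CCMFCQ g h xs)
    (hgs : ∀ i, g xs i ≤ 0) (hhs : ∀ i, h xs i = 0)
    (hstrict : ∀ x, dist x xs ≤ r → (∀ i, g x i ≤ 0) → (∀ i, h x i = 0) →
      (∀ i, xs i = 0 → x i = 0) → x ≠ xs → f xs < f x)
    {t : ℕ → ℝ} (ht : ∀ k, 0 < t k) (htl : Tendsto t atTop (𝓝 0)) :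
    ∀ᶠ k in atTop, ∃ z, KKTReg f g h κ (t k) z ∧ dist z.1 xs < r := by
  have hgc := fun i => (hg i).continuous
  have hhc := fun i => (hh i).continuous
  choose z hz hzr hzmin using fun k =>
    exists_isMin_ZReg (t := t k) (r := r) (xs := xs) hf.continuous hgc hhc
    ⟨_, ZSet_subset_ZReg (ht k).le (mk_indicator_mem_ZSet hcard hgs hhs fun _ hi => hi),
      by simpa using hr.le⟩
  have hzl := tendsto_of_isMin hf.continuous hgc hhc hc hr.le hcx hcard hgs hhs hstrict ht htl hz
    hzr hzmin
  have hxl : Tendsto (fun k => (z k).1) atTop (𝓝 xs) := (continuous_fst.tendsto _).comp hzl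
  obtain ⟨i₀, hi₀⟩ : ∃ i, xs i ≠ 0 := by
    by_contra! h0
    simp [card0, h0] at hcard
    omega
  have hyl : Tendsto (fun k => (z k).2 i₀) atTop (𝓝 0) := by
    have h1 := (((continuous_apply i₀).comp continuous_snd).tendsto _).comp hzl
    simp only [Function.comp_apply, hi₀, if_false] at h1
    exact h1
  have hxr : ∀ᶠ k in atTop, dist (z k).1 xs < r := hxl.eventually (Metric.ball_mem_nhds xs hr)
  have hmult : ∀ᶠ k in atTop, ∃ w, w ≠ 0 ∧ IsRegFJMult f g h κ (t k) (z k) w := by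
    filter_upwards [hxr, hyl.eventually_lt_const one_pos] with k hk hyk
    refine exists_isRegFJMult_of_localMin hf hg hh (ht k) (hz k) (sub_pos.2 hk)
      (fun z' hz' hd => hzmin k z' hz' ?_) ⟨i₀, hyk.ne⟩
    have h1 : dist z'.1 (z k).1 ≤ r - dist (z k).1 xs := (le_max_left _ _).trans hd
    exact (dist_triangle _ (z k).1 _).trans (by linarith)
  by_contra hcon
  obtain ⟨φ, hφ, hbad⟩ := extraction_of_frequently_atTop
    ((not_eventually.1 hcon).and_eventually (hxr.and hmult))
  choose hno hd w hw0 hwm using hbad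
  obtain ⟨w₀, hw₀, hm₀, hzero⟩ := exists_isTightFJMult_of_tendsto (t := fun k => t (φ k))
    (z := fun k => z (φ k)) hf hg hh hc hcard (fun _ => ht _) (htl.comp hφ.tendsto_atTop)
    (fun _ => hz _) (fun _ => hcx _ (hzr _)) (hxl.comp hφ.tendsto_atTop) hwm hw0
  refine (hm₀.obj_pos hmfcq hw₀).ne' (hzero fun k => ?_)
  by_contra hne
  exact hno k ⟨_, (hwm k).kktReg (hz _) ((hwm k).2.1.lt_of_ne' hne), hd k⟩

end

theorem stmt15
    {n m p : ℕ} (f : (Fin n → ℝ) → ℝ) (g : (Fin n → ℝ) → Fin m → ℝ)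
    (h : (Fin n → ℝ) → Fin p → ℝ) (κ : ℕ)
    (hn : 0 < n) (hm : 0 < m) (hp : 0 < p) (hκ0 : 0 < κ) (hκn : κ < n)
    (hf : ContDiff ℝ 2 f) (hg : ∀ i, ContDiff ℝ 2 (fun x => g x i))
    (hh : ∀ i, ContDiff ℝ 2 (fun x => h x i))
    (xs ys : Fin n → ℝ) (hmin : StrictLocalMinX f g h κ (xs, ys))
    (hcard : card0 xs = κ) (hmfcq : CCMFCQ g h xs)
    (hsoc : ∀ (lam : Fin m → ℝ) (mu : Fin p → ℝ) (gam : Fin n → ℝ),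
      IsSMult f g h xs ys lam mu gam →
      ∀ dx dy : Fin n → ℝ, CritCone f g h κ xs ys dx dy → dx ≠ 0 →
        0 < D2 f xs dx + ∑ i, lam i * D2 (fun x' => g x' i) xs dx
        + ∑ i, mu i * D2 (fun x' => h x' i) xs dx) :
    ∃ r > (0 : ℝ), ∀ t : ℕ → ℝ, (∀ k, 0 < t k) → Tendsto t atTop (nhds 0) →
      (∀ᶠ k in atTop, ∃ z : (Fin n → ℝ) × (Fin n → ℝ),
        KKTReg f g h κ (t k) z ∧ dist z.1 xs < r) ∧
      ∀ z : ℕ → (Fin n → ℝ) × (Fin n → ℝ),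
        (∀ᶠ k in atTop, KKTReg f g h κ (t k) (z k) ∧ dist (z k).1 xs < r) →
        Tendsto z atTop (nhds (xs, ys)) := by
  set y₁ : Fin n → ℝ := fun i => if xs i = 0 then 1 else 0 with hy₁
  obtain ⟨hfeas, r₂, hr₂, hstr⟩ := hmin
  have hys : ys = y₁ := eq_indicator_of_mem_ZSet hcard hfeas
  obtain ⟨hgs, hhs, -⟩ := hfeas
  have hf1 : ContDiff ℝ 1 f := hf.of_le one_le_two
  have hg1 := fun i => (hg i).of_le one_le_two
  have hh1 := fun i => (hh i).of_le one_le_two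
  obtain ⟨c, hc, hcx⟩ := exists_pos_le_abs xs
  obtain ⟨r₁, hr₁, hiso⟩ := exists_isolated_isTightFJMult hf hg hh hgs hhs hmfcq
    fun w hw hpos d hd0 hdg hdh hdz hdf => by
      have hi := (inv_pos.2 hpos).le
      have hsm := hw.smul hi
      have hs1 : w.1⁻¹ * w.1 = 1 := inv_mul_cancel₀ hpos.ne'
      have hmult : IsSMult f g h xs ys (w.1⁻¹ • w.2.1) (w.1⁻¹ • w.2.2.1) (w.1⁻¹ • w.2.2.2) :=
        ⟨⟨fun e => by
          have := hsm.stat e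
          simp only [lagDeriv, Prod.smul_fst, Prod.smul_snd, smul_eq_mul, hs1, one_mul] at this
          exact this, hsm.lam_nonneg, hsm.compl, hsm.gam_eq_zero⟩,
          fun i h1 h2 => by simp [hys, hy₁, h1] at h2⟩
      have hcrit : CritCone f g h κ xs ys d 0 :=
        ⟨⟨hdg, hdh, by simp, by simp, by simp, by simp, fun i h1 _ => hdz i h1, by simp⟩, hdf⟩
      have := mul_pos hpos (hsoc _ _ _ hmult d 0 hcrit hd0)
      have hcan : ∀ a b, w.1 * (w.1⁻¹ * a * b) = a * b := fun a b => by
        rw [mul_assoc, mul_inv_cancel_left₀ hpos.ne']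
      simpa only [mul_add, Finset.mul_sum, Pi.smul_apply, smul_eq_mul, hcan] using this
  have hr : 0 < min c (min r₁ r₂) / 2 := by positivity
  set r := min c (min r₁ r₂) / 2 with hrdef
  have hrc : r ≤ c := by linarith [min_le_left c (min r₁ r₂)]
  have hrr : 2 * r ≤ min r₁ r₂ := by linarith [min_le_right c (min r₁ r₂)]
  have hrr₁ : r < r₁ := by linarith [min_le_left r₁ r₂]
  have hrr₂ : r < r₂ := by linarith [min_le_right r₁ r₂]
  have hcx' : ∀ x, dist x xs ≤ r → ∀ i, xs i ≠ 0 → c ≤ |x i| := fun x hx => hcx x (hx.trans hrc)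
  refine ⟨r, hr, fun t ht htl => ⟨?_, fun z hz => ?_⟩⟩
  · refine eventually_exists_kktReg hf1 hg1 hh1 hc hr hcx' hκ0 hcard hmfcq hgs hhs
      (fun x hx h1 h2 h3 hne => hstr (x, ys) (hys ▸ mk_indicator_mem_ZSet hcard h1 h2 h3) ?_ hne)
      ht htl
    rw [Prod.dist_eq, dist_self]
    exact max_lt (hx.trans_lt hrr₂) hr₂
  · obtain ⟨N, hN⟩ := eventually_atTop.1 hz
    rw [hys, ← tendsto_add_atTop_iff_nat N]
    exact tendsto_of_isRegFJMult hf1 hg1 hh1 hc hcx' hcard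
      (fun x hx => hiso x (hx.trans_lt hrr₁)) (fun k => ht (k + N))
      ((tendsto_add_atTop_iff_nat N).2 htl) (fun k => (hN _ (Nat.le_add_left N k)).1.1)
      (fun k => (hN _ (Nat.le_add_left N k)).2.le)
      fun k => (hN _ (Nat.le_add_left N k)).1.exists_isRegFJMult
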